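/- Let d = 4 and let u(·,t) = G(·,t) * f (discrete convolution over ℤ^4) be the solution of the linear discrete wave equation with zero initial position and initial velocity f. For all 1 ≤ p < q ≤ ∞ with 1/p − 1/q ≥ 1/2 and every ε > 0 there exists C = C(p,q,ε) > 0 such that ‖u(·,t)‖_{l^q(ℤ^4)} ≤ C (1+|t|)^{-(3-ε)(1/p − 1/q − 1/2)} ‖f‖_{l^p(ℤ^4)} for all t ∈ ℝ and all f ∈ l^p(ℤ^4). -/

import Mathlib

open MeasureTheory Complex ENNReal

/-- `ω(ξ) = (∑ (2 - 2cos ξ_j))^{1/2}` -/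
noncomputable def discOmega (d : ℕ) (ξ : Fin d → ℝ) : ℝ :=
  Real.sqrt (∑ j, (2 - 2 * Real.cos (ξ j)))

/-- the cube `[-π,π]^d` -/
def torusBox (d : ℕ) : Set (Fin d → ℝ) :=
  Set.univ.pi fun _ => Set.Icc (-Real.pi) Real.pi

/-- Green's function of the discrete wave equation on `ℤ^d`. -/
noncomputable def greenG (d : ℕ) (x : Fin d → ℤ) (t : ℝ) : ℂ :=
  ((2 * Real.pi : ℂ) ^ d)⁻¹ *
    ∫ ξ in torusBox d,
      Complex.exp (Complex.I * ((∑ j, (x j : ℝ) * ξ j : ℝ) : ℂ)) *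
        ((Real.sin (t * discOmega d ξ) / discOmega d ξ : ℝ) : ℂ)

/-- the `l^p` norm on `ℤ^d` (with respect to counting measure). -/
noncomputable def lpNorm (d : ℕ) (p : ℝ≥0∞) (f : (Fin d → ℤ) → ℂ) : ℝ≥0∞ :=
  eLpNorm f p Measure.count

/-- If `‖f‖ ≤ F'` on `[a, b]`, then `‖∫ f‖ ≤ F b - F a`. -/
lemma norm_integral_le_sub_of_hasDerivAt {f : ℝ → ℂ} {F F' : ℝ → ℝ} {a b : ℝ} (hab : a ≤ b)
    (hF : ∀ x, HasDerivAt F (F' x) x) (hF' : Continuous F')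
    (hf : ∀ x ∈ Set.Icc a b, ‖f x‖ ≤ F' x) :
    ‖∫ x in a..b, f x‖ ≤ F b - F a := by
  rw [← intervalIntegral.integral_eq_sub_of_hasDerivAt (fun x _ => hF x)
    (hF'.intervalIntegrable a b)]
  refine intervalIntegral.norm_integral_le_of_norm_le hab ?_ (hF'.intervalIntegrable a b)
  exact Filter.Eventually.of_forall fun x hx => hf x ⟨hx.1.le, hx.2⟩

lemma abs_div_sq_add_sq_le {m : ℝ} (hm : 0 < m) (y : ℝ) : |y / (m ^ 2 + y ^ 2)| ≤ 1 / (2 * m) := by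
  rw [abs_div, abs_of_pos (by positivity : 0 < m ^ 2 + y ^ 2),
    div_le_div_iff₀ (by positivity) (by positivity)]
  nlinarith [sq_nonneg (m - |y|), sq_abs y]

/-- Integration by parts splits an oscillatory integral with monotone amplitude and concave phase
into a part where the phase is almost stationary and a remainder of size `1 / m`. -/
lemma norm_oscillatory_le {φ φ' φ'' A A' : ℝ → ℝ} {a b m : ℝ} (hab : a ≤ b) (hm : 0 < m)
    (hφ : ∀ x, HasDerivAt φ (φ' x) x) (hφ' : ∀ x, HasDerivAt φ' (φ'' x) x)
    (hφ'' : Continuous φ'') (hA : ∀ x, HasDerivAt A (A' x) x) (hA' : Continuous A')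
    (hA0 : ∀ x, 0 ≤ A x) (hA1 : ∀ x, A x ≤ 1) (hconc : ∀ x ∈ Set.Icc a b, φ'' x ≤ 0)
    {e : ℝ} (he : |e| = 1) (hmono : ∀ x ∈ Set.Icc a b, |A' x| = e * A' x) :
    ‖∫ x in a..b, (A x : ℂ) * cexp (I * φ x)‖ ≤
      (∫ x in a..b, m ^ 2 / (m ^ 2 + φ' x ^ 2)) + 6 / m := by
  have cφ : Continuous φ := continuous_iff_continuousAt.2 fun x => (hφ x).continuousAt
  have cφ' : Continuous φ' := continuous_iff_continuousAt.2 fun x => (hφ' x).continuousAt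
  have cA : Continuous A := continuous_iff_continuousAt.2 fun x => (hA x).continuousAt
  have hpos : ∀ y : ℝ, 0 < m ^ 2 + y ^ 2 := fun y => by positivity
  have hne : ∀ y : ℝ, m ^ 2 + y ^ 2 ≠ 0 := fun y => (hpos y).ne'
  set g : ℝ → ℝ := fun x => φ' x / (m ^ 2 + φ' x ^ 2) with hg
  set g' : ℝ → ℝ := fun x => (m ^ 2 - φ' x ^ 2) * φ'' x / (m ^ 2 + φ' x ^ 2) ^ 2 with hg'
  have dg : ∀ x, HasDerivAt g (g' x) x := fun x => by
    have := (hφ' x).div (((hφ' x).pow 2).const_add (m ^ 2)) (hne _)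
    refine this.congr_deriv ?_
    simp only [hg', Pi.pow_apply]; congr 1; push_cast; ring
  have cg : Continuous g := continuous_iff_continuousAt.2 fun x => (dg x).continuousAt
  have cg' : Continuous g' := by
    simp only [hg']
    exact Continuous.div (by fun_prop) (by fun_prop) fun x => pow_ne_zero _ (hne _)
  set B : ℝ → ℝ := fun x => A x * g x with hB
  set B' : ℝ → ℝ := fun x => A' x * g x + A x * g' x with hB'
  have dB : ∀ x, HasDerivAt B (B' x) x := fun x => (hA x).mul (dg x)
  have cB' : Continuous B' := by simp only [hB']; fun_prop
  have cB : Continuous B := by simp only [hB]; fun_prop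
  have dE : ∀ x, HasDerivAt (fun x => (B x : ℂ) * cexp (I * φ x))
      ((B' x : ℂ) * cexp (I * φ x) + I * ((B x * φ' x : ℝ) : ℂ) * cexp (I * φ x)) x := fun x => by
    have := (dB x).ofReal_comp.mul (((hφ x).ofReal_comp.const_mul I).cexp)
    refine this.congr_deriv ?_
    push_cast; ring
  have hgb : ∀ x, |g x| ≤ 1 / (2 * m) := fun x => abs_div_sq_add_sq_le hm _
  have hBb : ∀ x, |B x| ≤ 1 / (2 * m) := fun x => by
    rw [hB, abs_mul, abs_of_nonneg (hA0 x)]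
    calc A x * |g x| ≤ 1 * |g x| := by gcongr; exact hA1 x
      _ ≤ _ := by rw [one_mul]; exact hgb x
  have hexp : ∀ x, ‖cexp (I * φ x)‖ = 1 := fun x => by
    rw [mul_comm]; exact norm_exp_ofReal_mul_I _
  have key : ∀ x, (A x : ℂ) * cexp (I * φ x) =
      ((A x * (m ^ 2 / (m ^ 2 + φ' x ^ 2)) : ℝ) : ℂ) * cexp (I * φ x)
      + -I * ((B' x : ℂ) * cexp (I * φ x) + I * ((B x * φ' x : ℝ) : ℂ) * cexp (I * φ x))
      + I * ((B' x : ℂ) * cexp (I * φ x)) := fun x => by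
    have h1 : A x = A x * (m ^ 2 / (m ^ 2 + φ' x ^ 2)) + B x * φ' x := by
      simp only [hB, hg]; field_simp [hne (φ' x)]
    conv_lhs => rw [h1]
    push_cast
    linear_combination ((B x : ℂ) * φ' x * cexp (I * φ x)) * I_sq
  have i1 : IntervalIntegrable (fun x => ((A x * (m ^ 2 / (m ^ 2 + φ' x ^ 2)) : ℝ) : ℂ) *
      cexp (I * φ x)) volume a b := by
    apply Continuous.intervalIntegrable
    have : Continuous fun x => m ^ 2 / (m ^ 2 + φ' x ^ 2) :=
      Continuous.div (by fun_prop) (by fun_prop) fun x => hne _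
    fun_prop
  have i2 : IntervalIntegrable (fun x => (B' x : ℂ) * cexp (I * φ x) +
      I * ((B x * φ' x : ℝ) : ℂ) * cexp (I * φ x)) volume a b := by
    apply Continuous.intervalIntegrable; fun_prop
  have i3 : IntervalIntegrable (fun x => (B' x : ℂ) * cexp (I * φ x)) volume a b := by
    apply Continuous.intervalIntegrable; fun_prop
  simp_rw [key]
  rw [intervalIntegral.integral_add (i1.add (i2.const_mul _)) (i3.const_mul _),
    intervalIntegral.integral_add i1 (i2.const_mul _), intervalIntegral.integral_const_mul,
    intervalIntegral.integral_const_mul,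
    intervalIntegral.integral_eq_sub_of_hasDerivAt (fun x _ => dE x) i2]
  have n1 : ‖∫ x in a..b, ((A x * (m ^ 2 / (m ^ 2 + φ' x ^ 2)) : ℝ) : ℂ) * cexp (I * φ x)‖ ≤
      ∫ x in a..b, m ^ 2 / (m ^ 2 + φ' x ^ 2) := by
    refine intervalIntegral.norm_integral_le_of_norm_le hab ?_ ?_
    · refine Filter.Eventually.of_forall fun x _ => ?_
      rw [norm_mul, hexp, mul_one, norm_real, Real.norm_of_nonneg
        (mul_nonneg (hA0 x) (by positivity))]
      exact mul_le_of_le_one_left (by positivity) (hA1 x)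
    · apply Continuous.intervalIntegrable
      exact Continuous.div (by fun_prop) (by fun_prop) fun x => hne _
  have hnB : ∀ x, ‖(B x : ℂ) * cexp (I * φ x)‖ ≤ 1 / (2 * m) := fun x => by
    rw [norm_mul, hexp, mul_one, norm_real]; exact hBb x
  have n2 : ‖-I * ((B b : ℂ) * cexp (I * φ b) - (B a : ℂ) * cexp (I * φ a))‖ ≤ 1 / m := by
    rw [norm_mul, norm_neg, norm_I, one_mul]
    refine (norm_sub_le _ _).trans ((add_le_add (hnB b) (hnB a)).trans (le_of_eq ?_))
    field_simp; norm_num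
  have n3 : ‖I * ∫ x in a..b, (B' x : ℂ) * cexp (I * φ x)‖ ≤ 5 / m := by
    rw [norm_mul, norm_I, one_mul]
    have := norm_integral_le_sub_of_hasDerivAt (f := fun x => (B' x : ℂ) * cexp (I * φ x))
      (F := fun x => e * A x * (1 / (2 * m)) - Real.arctan (φ' x / m) / m)
      (F' := fun x => e * A' x * (1 / (2 * m)) - φ'' x / (m ^ 2 + φ' x ^ 2)) hab ?_ ?_ ?_
    · refine this.trans ?_
      have hp := Real.pi_lt_four
      have a1 := Real.arctan_lt_pi_div_two (φ' a / m)
      have a2 := Real.neg_pi_div_two_lt_arctan (φ' b / m)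
      have e1 : e * (A b - A a) ≤ 1 := by
        refine (le_abs_self _).trans ?_
        rw [abs_mul, he, one_mul, abs_le]
        constructor <;> linarith [hA0 a, hA0 b, hA1 a, hA1 b]
      have : e * A b * (1 / (2 * m)) - Real.arctan (φ' b / m) / m -
          (e * A a * (1 / (2 * m)) - Real.arctan (φ' a / m) / m) =
          (e * (A b - A a) / 2 - Real.arctan (φ' b / m) + Real.arctan (φ' a / m)) / m := by
        field_simp; ring
      rw [this]
      gcongr
      linarith
    · intro x
      have h1 := ((hA x).const_mul e).mul_const (1 / (2 * m))
      have h2 := (((hφ' x).div_const m).arctan).div_const m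
      refine (h1.sub h2).congr_deriv ?_
      have := hne (φ' x)
      field_simp
    · have : Continuous fun x => φ'' x / (m ^ 2 + φ' x ^ 2) :=
        Continuous.div (by fun_prop) (by fun_prop) fun x => hne _
      fun_prop
    · intro x hx
      rw [norm_mul, hexp, mul_one, norm_real, Real.norm_eq_abs]
      refine (abs_add_le _ _).trans ?_
      rw [sub_eq_add_neg]
      refine add_le_add ?_ ?_
      · rw [abs_mul, ← hmono x hx]
        exact mul_le_mul_of_nonneg_left (hgb x) (abs_nonneg _)
      · rw [abs_mul, abs_of_nonneg (hA0 x)]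
        refine (mul_le_of_le_one_left (abs_nonneg _) (hA1 x)).trans ?_
        simp only [hg']
        rw [abs_div, abs_mul, abs_of_nonpos (hconc x hx), abs_of_pos (pow_pos (hpos _) 2),
          ← neg_div, div_le_div_iff₀ (pow_pos (hpos _) 2) (hpos _)]
        have h3 : |m ^ 2 - φ' x ^ 2| ≤ m ^ 2 + φ' x ^ 2 := by
          rw [abs_le]; constructor <;> nlinarith [sq_nonneg (φ' x), sq_nonneg m]
        have h4 : 0 ≤ -φ'' x := by linarith [hconc x hx]
        calc |m ^ 2 - φ' x ^ 2| * -φ'' x * (m ^ 2 + φ' x ^ 2)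
            ≤ (m ^ 2 + φ' x ^ 2) * -φ'' x * (m ^ 2 + φ' x ^ 2) := by
              gcongr
          _ = _ := by ring
  refine (norm_add₃_le).trans ?_
  have : 6 / m = 1 / m + 5 / m := by ring
  rw [this]
  linarith

lemma one_div_one_add_sq_le_of_stationary {m r w z q : ℝ} (hm : 0 < m) (hr : 0 < r) (hw : 0 ≤ w)
    (hz : z = w ^ 2) (h : m ^ 2 ≤ 10 * r ^ 2 * z) (hq : q ≤ z) :
    m * (1 + q) ≤ 9 * r * (1 + z ^ 2) := by
  have h1 : m ≤ 4 * r * w := by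
    apply le_of_sq_le_sq _ (by positivity)
    nlinarith [mul_nonneg (sq_nonneg r) (sq_nonneg w)]
  have h2 : 4 * w * (1 + w ^ 2) ≤ 9 * (1 + w ^ 4) := by
    nlinarith [sq_nonneg (w - 1), sq_nonneg (w ^ 2 - 1), sq_nonneg (w ^ 2 - w)]
  calc m * (1 + q) ≤ m * (1 + z) := by gcongr
    _ ≤ 4 * r * w * (1 + z) := by gcongr; rw [hz]; positivity
    _ = r * (4 * w * (1 + w ^ 2)) := by rw [hz]; ring
    _ ≤ r * (9 * (1 + w ^ 4)) := by gcongr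
    _ = _ := by rw [hz]; ring

/-- The stationary part of the phase `s sin θ - ν θ` has measure `O(1 / m)`,
where `m ^ 4 = s |s - ν|`. -/
lemma integral_stationary_le {m s ν : ℝ} (hm : 0 < m) (hs : 0 < s) (h : m ^ 4 = s * |s - ν|) :
    ∫ θ in (0 : ℝ)..(Real.pi / 2), m ^ 2 / (m ^ 2 + (s * Real.cos θ - ν) ^ 2) ≤ 20 / m := by
  have hpi := Real.pi_pos
  have hab : (0 : ℝ) ≤ Real.pi / 2 := by positivity
  set r : ℝ := Real.sqrt (s / (5 * m)) with hr
  have hr0 : 0 < r := Real.sqrt_pos.2 (by positivity)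
  have hsr : s = 5 * m * r ^ 2 := by
    rw [hr, Real.sq_sqrt (by positivity)]; field_simp
  have hpos : ∀ θ : ℝ, 0 < m ^ 2 + (s * Real.cos θ - ν) ^ 2 := fun θ => by positivity
  have hpos2 : ∀ θ : ℝ, 0 < 1 + (r * θ) ^ 2 := fun θ => by positivity
  set F : ℝ → ℝ := fun θ => -(3 / 2 / m) * Real.arctan ((s * Real.cos θ - ν) / m)
    + 9 / m * Real.arctan (r * θ) with hF
  set F' : ℝ → ℝ := fun θ => 3 / 2 * s * Real.sin θ / (m ^ 2 + (s * Real.cos θ - ν) ^ 2)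
    + 9 * r / m / (1 + (r * θ) ^ 2) with hF'
  have dF : ∀ θ, HasDerivAt F (F' θ) θ := fun θ => by
    have h1 := ((((Real.hasDerivAt_cos θ).const_mul s).sub_const ν).div_const m).arctan.const_mul
      (-(3 / 2 / m))
    have h2 := (((hasDerivAt_id θ).const_mul r).arctan).const_mul (9 / m)
    refine (h1.add h2).congr_deriv ?_
    have := (hpos θ).ne'
    have := (hpos2 θ).ne'
    simp only [hF', id]
    field_simp
  have cF' : Continuous F' := by
    refine Continuous.add (Continuous.div (by fun_prop) (by fun_prop) fun θ => (hpos θ).ne')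
      (Continuous.div (by fun_prop) (by fun_prop) fun θ => (hpos2 θ).ne')
  have cI : Continuous fun θ => m ^ 2 / (m ^ 2 + (s * Real.cos θ - ν) ^ 2) :=
    Continuous.div (by fun_prop) (by fun_prop) fun θ => (hpos θ).ne'
  have hle : ∀ θ ∈ Set.Icc 0 (Real.pi / 2), m ^ 2 / (m ^ 2 + (s * Real.cos θ - ν) ^ 2) ≤ F' θ := by
    intro θ hθ
    have hsin : 0 ≤ Real.sin θ := Real.sin_nonneg_of_nonneg_of_le_pi hθ.1 (by linarith [hθ.2])
    have hcos : 0 ≤ Real.cos θ :=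
      Real.cos_nonneg_of_neg_pi_div_two_le_of_le (by linarith [hθ.1]) hθ.2
    have hcos1 := Real.cos_le_one θ
    set Y := s * Real.cos θ - ν with hY
    have tri : |s - ν| ≤ s * (1 - Real.cos θ) + |Y| := by
      have : s - ν = s * (1 - Real.cos θ) + Y := by rw [hY]; ring
      rw [this]
      refine (abs_add_le _ _).trans (le_of_eq ?_)
      rw [abs_of_nonneg (mul_nonneg hs.le (by linarith))]
    have p1 : 0 ≤ 3 / 2 * s * Real.sin θ / (m ^ 2 + Y ^ 2) := by positivity
    have p2 : 0 ≤ 9 * r / m / (1 + (r * θ) ^ 2) := by positivity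
    rcases le_or_gt (s * (1 - Real.cos θ)) |Y| with hc | hc
    · refine le_trans ?_ (le_add_of_nonneg_left p1)
      set z := |Y| / m with hz
      have hYz : |Y| = m * z := by rw [hz]; field_simp
      have hz0 : 0 ≤ z := by positivity
      have hY2 : Y ^ 2 = m ^ 2 * z ^ 2 := by rw [← sq_abs, hYz]; ring
      have hq : (r * θ) ^ 2 ≤ z := by
        have hb := Real.cos_le_one_sub_mul_cos_sq (x := θ) (by
          rw [abs_of_nonneg hθ.1]; linarith [hθ.2])
        have h5 : (1 : ℝ) / 5 ≤ 2 / Real.pi ^ 2 := by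
          rw [div_le_div_iff₀ (by norm_num) (by positivity)]
          nlinarith [Real.pi_lt_d2]
        have h6 : θ ^ 2 / 5 ≤ 1 - Real.cos θ := by
          nlinarith [mul_le_mul_of_nonneg_right h5 (sq_nonneg θ)]
        have : m * (r * θ) ^ 2 ≤ m * z := by
          rw [← hYz]
          refine le_trans ?_ hc
          rw [hsr]
          have : 0 ≤ 5 * m * r ^ 2 := by positivity
          nlinarith [mul_le_mul_of_nonneg_left h6 this]
        exact le_of_mul_le_mul_left this hm
      have hm2 : m ^ 2 ≤ 10 * r ^ 2 * z := by
        have h7 : m ^ 4 ≤ s * (2 * |Y|) := by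
          rw [h]; gcongr; linarith
        have h8 : m ^ 2 * m ^ 2 ≤ m ^ 2 * (10 * r ^ 2 * z) := by
          calc m ^ 2 * m ^ 2 = m ^ 4 := by ring
            _ ≤ _ := h7
            _ = _ := by rw [hYz, hsr]; ring
        exact le_of_mul_le_mul_left h8 (by positivity)
      have := one_div_one_add_sq_le_of_stationary hm hr0 (Real.sqrt_nonneg z)
        (Real.sq_sqrt hz0).symm hm2 hq
      rw [hY2, div_div, div_le_div_iff₀ (by positivity) (by positivity)]
      nlinarith [mul_le_mul_of_nonneg_left this (by positivity : 0 ≤ m ^ 2)]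
    · refine le_trans ?_ (le_add_of_nonneg_right p2)
      gcongr
      apply le_of_sq_le_sq _ (by positivity)
      have h7 : m ^ 4 ≤ s * (2 * (s * (1 - Real.cos θ))) := by
        rw [h]; gcongr; linarith
      have h8 : 1 - Real.cos θ ≤ Real.sin θ ^ 2 := by
        nlinarith [Real.sin_sq_add_cos_sq θ]
      nlinarith [mul_le_mul_of_nonneg_left h8 (by positivity : 0 ≤ s ^ 2)]
  calc _ ≤ ∫ θ in (0 : ℝ)..(Real.pi / 2), F' θ :=
        intervalIntegral.integral_mono_on hab (cI.intervalIntegrable _ _)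
          (cF'.intervalIntegrable _ _) hle
    _ = F (Real.pi / 2) - F 0 :=
        intervalIntegral.integral_eq_sub_of_hasDerivAt (fun x _ => dF x)
          (cF'.intervalIntegrable _ _)
    _ ≤ 20 / m := by
        have a1 := Real.neg_pi_div_two_lt_arctan ((s * Real.cos (Real.pi / 2) - ν) / m)
        have a2 := Real.arctan_lt_pi_div_two ((s * Real.cos 0 - ν) / m)
        have a3 := Real.arctan_lt_pi_div_two (r * (Real.pi / 2))
        have : F (Real.pi / 2) - F 0 =
          (-(3 / 2) * Real.arctan ((s * Real.cos (Real.pi / 2) - ν) / m)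
            + 9 * Real.arctan (r * (Real.pi / 2))
            + 3 / 2 * Real.arctan ((s * Real.cos 0 - ν) / m)) / m := by
          simp only [hF, mul_zero, Real.arctan_zero]; ring
        rw [this]
        gcongr
        linarith [Real.pi_lt_d2]

/-- Bound for a quarter of a (damped) Bessel integral. -/
lemma norm_quarter_bessel_le {m s ν k e : ℝ} (hm : 0 < m) (hs : 0 < s) (hk : 0 ≤ k)
    (he : e = 1 ∨ e = -1) (h : m ^ 4 ≤ s * |s - ν|) :
    ‖∫ θ in (0 : ℝ)..(Real.pi / 2), (Real.exp (-k * (1 - e * Real.sin θ)) : ℂ) *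
      cexp (I * ((s * Real.sin θ - ν * θ : ℝ) : ℂ))‖ ≤ 26 / m := by
  have hpi := Real.pi_pos
  have hab : (0 : ℝ) ≤ Real.pi / 2 := by positivity
  set M : ℝ := (s * |s - ν|) ^ (1 / 4 : ℝ) with hM
  have hp : 0 < s * |s - ν| := lt_of_lt_of_le (by positivity) h
  have hM0 : 0 < M := Real.rpow_pos_of_pos hp _
  have hM4 : M ^ 4 = s * |s - ν| := by
    rw [hM, ← Real.rpow_natCast, ← Real.rpow_mul hp.le]; norm_num
  have hmM : m ≤ M := by
    rw [← hM4] at h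
    exact le_of_pow_le_pow_left₀ (by norm_num) hM0.le h
  refine le_trans ?_ (div_le_div_of_nonneg_left (by norm_num) hm hmM)
  have hes : ∀ x : ℝ, e * Real.sin x ≤ 1 := fun x => by
    rcases he with rfl | rfl <;> linarith [Real.sin_le_one x, Real.neg_one_le_sin x]
  have he1 : |e| = 1 := by rcases he with rfl | rfl <;> simp
  have hee : |e| = e * e := by rcases he with rfl | rfl <;> simp
  have := norm_oscillatory_le (φ := fun θ => s * Real.sin θ - ν * θ)
    (φ' := fun θ => s * Real.cos θ - ν) (φ'' := fun θ => s * -Real.sin θ)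
    (A := fun θ => Real.exp (-k * (1 - e * Real.sin θ)))
    (A' := fun θ => Real.exp (-k * (1 - e * Real.sin θ)) * (-k * -(e * Real.cos θ)))
    hab hM0
    (fun x => by
      exact (((Real.hasDerivAt_sin x).const_mul s).sub
        ((hasDerivAt_id x).const_mul ν)).congr_deriv (by ring))
    (fun x => ((Real.hasDerivAt_cos x).const_mul s).sub_const ν)
    (by fun_prop)
    (fun x => ((((Real.hasDerivAt_sin x).const_mul e).const_sub 1).const_mul (-k)).exp)
    (by fun_prop) (fun x => (Real.exp_pos _).le)
    (fun x => by
      rw [Real.exp_le_one_iff]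
      nlinarith [hes x])
    (fun x hx => by
      have := Real.sin_nonneg_of_nonneg_of_le_pi hx.1 (by linarith [hx.2])
      nlinarith)
    he1
    (fun x hx => by
      have := Real.cos_nonneg_of_neg_pi_div_two_le_of_le (by linarith [hx.1]) hx.2
      rw [abs_mul, Real.abs_exp, neg_mul_neg, abs_mul, abs_mul, abs_of_nonneg hk,
        abs_of_nonneg this, hee]
      ring)
  refine this.trans ?_
  have := integral_stationary_le hM0 hs hM4
  calc _ ≤ 20 / M + 6 / M := by gcongr
    _ = _ := by ring

/-- The one-dimensional kernel `∫ e^{inξ + (i - δ) σ (2 - 2 cos ξ)} dξ`, without its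
normalising factor. -/
noncomputable def besselKernel (δ : ℝ) (n : ℤ) (σ : ℝ) : ℂ :=
  ∫ ξ in Set.Icc (-Real.pi) Real.pi,
    cexp (I * (n * ξ : ℝ)) * cexp ((I - δ) * σ * (2 - 2 * Real.cos ξ : ℝ))

lemma norm_exp_mul_exp_le {δ σ y lam : ℝ} (hδ : 0 ≤ δ) (hσ : 0 ≤ σ) (hlam : 0 ≤ lam) :
    ‖cexp (I * (y : ℝ)) * cexp ((I - δ) * σ * (lam : ℝ))‖ ≤ 1 := by
  rw [norm_mul, Complex.norm_exp, Complex.norm_exp]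
  simp
  positivity

lemma norm_besselKernel_le {δ σ : ℝ} (hδ : 0 ≤ δ) (hσ : 0 ≤ σ) (n : ℤ) :
    ‖besselKernel δ n σ‖ ≤ 2 * Real.pi := by
  have := norm_setIntegral_le_of_norm_le_const (μ := volume)
    (s := Set.Icc (-Real.pi) Real.pi) (C := 1) (by simp)
    (f := fun ξ : ℝ => cexp (I * (n * ξ : ℝ)) * cexp ((I - δ) * σ * (2 - 2 * Real.cos ξ : ℝ)))
    (fun ξ _ => norm_exp_mul_exp_le hδ hσ (by linarith [Real.cos_le_one ξ]))
  refine this.trans (le_of_eq ?_)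
  rw [one_mul, measureReal_def, Real.volume_Icc, ENNReal.toReal_ofReal] <;>
    linarith [Real.pi_pos]

/-- The quarter integral estimate with both orientations of the phase. -/
lemma norm_quarter_bessel_le_of_eq {m s ν k e η : ℝ} (hm : 0 < m) (hs : 0 < s) (hk : 0 ≤ k)
    (he : e = 1 ∨ e = -1) (hη : η = 1 ∨ η = -1) (h : m ^ 4 ≤ s * |s - ν|) {f : ℝ → ℂ} {c : ℝ}
    (hf : ∀ θ, f θ = cexp (I * c) * ((Real.exp (-k * (1 - e * Real.sin θ)) : ℂ) *
      cexp (I * ((η * (s * Real.sin θ - ν * θ) : ℝ) : ℂ)))) :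
    ‖∫ θ in (0 : ℝ)..(Real.pi / 2), f θ‖ ≤ 26 / m := by
  have h0 := norm_quarter_bessel_le hm hs hk he h
  simp_rw [hf]
  rw [intervalIntegral.integral_const_mul, norm_mul, mul_comm I (c : ℂ), norm_exp_ofReal_mul_I,
    one_mul]
  rcases hη with rfl | rfl
  · simpa using h0
  · rw [← RCLike.norm_conj, intervalIntegral.integral_of_le (by positivity),
      ← integral_conj, ← intervalIntegral.integral_of_le (by positivity)] at h0
    refine le_of_eq_of_le ?_ h0
    congr 2
    ext θ
    rw [map_mul, conj_ofReal, ← Complex.exp_conj, map_mul, conj_I, conj_ofReal]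
    congr 2
    push_cast; ring

/-- The pointwise bound `|J_n(s)| ≲ (s |s - |n||)^{-1/4}`, uniform in the damping. -/
lemma norm_besselKernel_le_div {δ σ m : ℝ} (hδ : 0 ≤ δ) (hσ : 0 < σ) (n : ℤ) (hm : 0 < m)
    (h : m ^ 4 ≤ 2 * σ * |2 * σ - (|n| : ℤ)|) : ‖besselKernel δ n σ‖ ≤ 104 / m := by
  have hpi := Real.pi_pos
  set f : ℝ → ℂ := fun ξ => cexp (I * (n * ξ : ℝ)) * cexp ((I - δ) * σ * (2 - 2 * Real.cos ξ : ℝ))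
    with hf
  have cf : Continuous f := by simp only [hf]; fun_prop
  have ii : ∀ a b, IntervalIntegrable f volume a b := fun a b => cf.intervalIntegrable a b
  have hs : 0 < 2 * σ := by linarith
  have hk : 0 ≤ δ * (2 * σ) := by positivity
  have hp : m ^ 4 ≤ 2 * σ * |2 * σ - n| := by
    refine h.trans ?_
    gcongr ?_ * ?_
    have := abs_abs_sub_abs_le (2 * σ) (n : ℝ)
    rw [abs_of_pos hs] at this
    simpa using this
  have hn : m ^ 4 ≤ 2 * σ * |2 * σ - (-n : ℝ)| := by
    refine h.trans ?_
    gcongr ?_ * ?_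
    have := abs_abs_sub_abs_le (2 * σ) (-n : ℝ)
    rw [abs_of_pos hs, abs_neg] at this
    simpa using this
  have e1 : ∫ ξ in (0 : ℝ)..(Real.pi / 2), f ξ =
      ∫ θ in (0 : ℝ)..(Real.pi / 2), f (Real.pi / 2 - θ) := by
    rw [intervalIntegral.integral_comp_sub_left]; simp
  have e2 : ∫ ξ in (Real.pi / 2)..Real.pi, f ξ =
      ∫ θ in (0 : ℝ)..(Real.pi / 2), f (Real.pi / 2 + θ) := by
    rw [intervalIntegral.integral_comp_add_left]; simp
  have e3 : ∫ ξ in (-(Real.pi / 2))..0, f ξ =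
      ∫ θ in (0 : ℝ)..(Real.pi / 2), f (-(Real.pi / 2) + θ) := by
    rw [intervalIntegral.integral_comp_add_left]; simp
  have e4 : ∫ ξ in (-Real.pi)..(-(Real.pi / 2)), f ξ =
      ∫ θ in (0 : ℝ)..(Real.pi / 2), f (-(Real.pi / 2) - θ) := by
    rw [intervalIntegral.integral_comp_sub_left]
    congr 1 <;> ring
  have split : besselKernel δ n σ = (∫ ξ in (-Real.pi)..(-(Real.pi / 2)), f ξ) +
      (∫ ξ in (-(Real.pi / 2))..0, f ξ) + (∫ ξ in (0 : ℝ)..(Real.pi / 2), f ξ) +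
      ∫ ξ in (Real.pi / 2)..Real.pi, f ξ := by
    rw [intervalIntegral.integral_add_adjacent_intervals (ii _ _) (ii _ _),
      intervalIntegral.integral_add_adjacent_intervals (ii _ _) (ii _ _),
      intervalIntegral.integral_add_adjacent_intervals (ii _ _) (ii _ _), besselKernel,
      integral_Icc_eq_integral_Ioc, intervalIntegral.integral_of_le (by linarith)]
  rw [split, e1, e2, e3, e4]
  have b1 : ‖∫ θ in (0 : ℝ)..(Real.pi / 2), f (Real.pi / 2 - θ)‖ ≤ 26 / m := by
    refine norm_quarter_bessel_le_of_eq (e := 1) (η := -1) (ν := -n)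
      (c := n * (Real.pi / 2) + 2 * σ) hm hs hk (by simp) (by simp) hn fun θ => ?_
    simp only [hf]
    rw [Real.cos_pi_div_two_sub, ofReal_exp, ← Complex.exp_add, ← Complex.exp_add,
      ← Complex.exp_add]
    congr 1; push_cast; ring
  have b2 : ‖∫ θ in (0 : ℝ)..(Real.pi / 2), f (Real.pi / 2 + θ)‖ ≤ 26 / m := by
    refine norm_quarter_bessel_le_of_eq (e := -1) (η := 1) (ν := -n)
      (c := n * (Real.pi / 2) + 2 * σ) hm hs hk (by simp) (by simp) hn fun θ => ?_
    simp only [hf]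
    rw [add_comm (Real.pi / 2) θ, Real.cos_add_pi_div_two, ofReal_exp, ← Complex.exp_add,
      ← Complex.exp_add, ← Complex.exp_add]
    congr 1; push_cast; ring
  have b3 : ‖∫ θ in (0 : ℝ)..(Real.pi / 2), f (-(Real.pi / 2) + θ)‖ ≤ 26 / m := by
    refine norm_quarter_bessel_le_of_eq (e := 1) (η := -1) (ν := n)
      (c := -n * (Real.pi / 2) + 2 * σ) hm hs hk (by simp) (by simp) hp fun θ => ?_
    simp only [hf]
    rw [neg_add_eq_sub, Real.cos_sub_pi_div_two, ofReal_exp, ← Complex.exp_add,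
      ← Complex.exp_add, ← Complex.exp_add]
    congr 1; push_cast; ring
  have b4 : ‖∫ θ in (0 : ℝ)..(Real.pi / 2), f (-(Real.pi / 2) - θ)‖ ≤ 26 / m := by
    refine norm_quarter_bessel_le_of_eq (e := -1) (η := 1) (ν := n)
      (c := -n * (Real.pi / 2) + 2 * σ) hm hs hk (by simp) (by simp) hp fun θ => ?_
    simp only [hf]
    rw [← neg_add', Real.cos_neg, add_comm (Real.pi / 2) θ, Real.cos_add_pi_div_two, ofReal_exp,
      ← Complex.exp_add, ← Complex.exp_add, ← Complex.exp_add]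
    congr 1; push_cast; ring
  refine (norm_add₄_le).trans ?_
  calc _ ≤ 26 / m + 26 / m + 26 / m + 26 / m := by gcongr
    _ = _ := by ring

lemma norm_besselKernel_pow_four_mul_le {δ σ : ℝ} (hδ : 0 ≤ δ) (hσ : 0 ≤ σ) (n : ℤ) :
    ‖besselKernel δ n σ‖ ^ 4 * (2 * σ * |2 * σ - (|n| : ℤ)|) ≤ 104 ^ 4 := by
  set P := 2 * σ * |2 * σ - (|n| : ℤ)| with hP
  have hP0 : 0 ≤ P := by positivity
  rcases hP0.eq_or_lt with h | h
  · rw [← h]; norm_num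
  · have hσ' : 0 < σ := by
      rcases hσ.eq_or_lt with h' | h'
      · rw [hP, ← h'] at h; simp at h
      · exact h'
    have hm : 0 < P ^ (1 / 4 : ℝ) := Real.rpow_pos_of_pos h _
    have hM4 : (P ^ (1 / 4 : ℝ)) ^ 4 = P := by
      rw [← Real.rpow_natCast, ← Real.rpow_mul hP0]; norm_num
    have := norm_besselKernel_le_div hδ hσ' n hm (hM4.le)
    rw [le_div_iff₀ hm] at this
    rw [← hM4, ← mul_pow]
    gcongr

lemma integrable_comp_abs_of_integrableOn {f : ℝ → ℝ} (hf : IntegrableOn f (Set.Ioi 0)) :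
    Integrable fun x => f |x| := by
  have h1 : IntegrableOn (fun x => f |x|) (Set.Ioi 0) :=
    hf.congr_fun (fun x hx => by simp only [abs_of_pos (Set.mem_Ioi.1 hx)]) measurableSet_Ioi
  have h2 : IntegrableOn (fun x => f |x|) (Set.Iic 0) := by
    rw [← Measure.map_neg_eq_self (volume : Measure ℝ)]
    let m : MeasurableEmbedding fun x : ℝ => -x := (Homeomorph.neg ℝ).measurableEmbedding
    rw [m.integrableOn_map_iff]
    simp_rw [Function.comp_def, abs_neg, Set.neg_preimage, Set.neg_Iic, neg_zero]
    exact Iff.mpr integrableOn_Ici_iff_integrableOn_Ioi h1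
  rw [← integrableOn_univ, ← Set.Iic_union_Ioi (a := (0 : ℝ))]
  exact h2.union h1

/-- A profile that is integrable at `0` and at infinity. -/
noncomputable def powerProfile (ε r : ℝ) : ℝ :=
  if r ≤ 1 then r ^ (-(1 - ε / 4)) else r ^ (-(1 + ε))

lemma powerProfile_nonneg {ε r : ℝ} (hr : 0 ≤ r) : 0 ≤ powerProfile ε r := by
  unfold powerProfile; split_ifs <;> positivity

lemma integrable_powerProfile_abs {ε : ℝ} (hε : 0 < ε) :
    Integrable fun v : ℝ => powerProfile ε |v| := by
  refine integrable_comp_abs_of_integrableOn ?_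
  rw [← Set.Ioc_union_Ioi_eq_Ioi zero_le_one]
  refine IntegrableOn.union ?_ ?_
  · have : IntegrableOn (fun r : ℝ => r ^ (-(1 - ε / 4))) (Set.Ioc 0 1) := by
      rw [← intervalIntegrable_iff_integrableOn_Ioc_of_le zero_le_one]
      exact intervalIntegral.intervalIntegrable_rpow' (by linarith)
    refine this.congr_fun (fun r hr => ?_) measurableSet_Ioc
    simp [powerProfile, hr.2]
  · have := integrableOn_Ioi_rpow_of_lt (a := -(1 + ε)) (by linarith) zero_lt_one
    refine this.congr_fun (fun r hr => ?_) measurableSet_Ioi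
    simp [powerProfile, not_le.2 (Set.mem_Ioi.1 hr)]

lemma rpow_mul_rpow_le_powerProfile {ε u v : ℝ} (hε : 0 < ε) (hε2 : ε ≤ 1) (hu : 1 < u)
    (hv : 0 < v) :
    u ^ (-(5 * ε / 4)) * v ^ (-(1 - ε / 4)) ≤ powerProfile ε v + powerProfile ε u := by
  have hu0 : 0 < u := by linarith
  rcases le_or_gt v 1 with h | h
  · refine le_trans ?_ (le_add_of_nonneg_right (powerProfile_nonneg hu0.le))
    rw [powerProfile, if_pos h]
    exact mul_le_of_le_one_left (by positivity)
      (Real.rpow_le_one_of_one_le_of_nonpos hu.le (by linarith))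
  · rcases le_total v u with h' | h'
    · refine le_trans ?_ (le_add_of_nonneg_right (powerProfile_nonneg hu0.le))
      rw [powerProfile, if_neg (not_le.2 h)]
      calc _ ≤ v ^ (-(5 * ε / 4)) * v ^ (-(1 - ε / 4)) := by
            gcongr ?_ * _
            exact Real.rpow_le_rpow_of_nonpos hv h' (by linarith)
        _ = _ := by rw [← Real.rpow_add hv]; congr 1; ring
    · refine le_trans ?_ (le_add_of_nonneg_left (powerProfile_nonneg hv.le))
      rw [powerProfile, if_neg (not_le.2 hu)]
      calc _ ≤ u ^ (-(5 * ε / 4)) * u ^ (-(1 - ε / 4)) := by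
            gcongr _ * ?_
            exact Real.rpow_le_rpow_of_nonpos hu0 h' (by linarith)
        _ = _ := by rw [← Real.rpow_add hu0]; congr 1; ring

/-- Interpolation between `X ≤ C` and `X P ≤ C`. -/
lemma le_mul_rpow_of_mul_le {X C P θ : ℝ} (hC : 0 ≤ C) (hP : 0 < P) (hθ0 : 0 ≤ θ) (hθ1 : θ ≤ 1)
    (h1 : X ≤ C) (h2 : X * P ≤ C) : X ≤ C * P ^ (-θ) := by
  rcases le_total P 1 with h | h
  · refine h1.trans (le_mul_of_one_le_right hC ?_)
    exact Real.one_le_rpow_of_pos_of_le_one_of_nonpos hP h (by linarith)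
  · calc X ≤ C * P ^ (-1 : ℝ) := by
          rw [Real.rpow_neg_one, ← div_eq_mul_inv, le_div_iff₀ hP]; exact h2
      _ ≤ _ := by
          exact mul_le_mul_of_nonneg_left (Real.rpow_le_rpow_of_exponent_le h (by linarith)) hC

/-- The pointwise form of the weighted fourth power estimate. -/
lemma weight_mul_norm_besselKernel_pow_four_le {ε δ u : ℝ} (hε : 0 < ε) (hε2 : ε ≤ 1 / 2)
    (hδ : 0 ≤ δ) (n : ℤ) (hu : 1 < u) (hun : u ≠ Real.sqrt ((|n| : ℤ) / 2)) :
    (u ^ (3 - 2 * ε) + u ^ (1 - 2 * ε)) * ‖besselKernel δ n (u ^ 2)‖ ^ 4 ≤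
      2 * 104 ^ 4 * (powerProfile ε |u - Real.sqrt ((|n| : ℤ) / 2)| + powerProfile ε |u|) := by
  have hu0 : 0 < u := by linarith
  set m := Real.sqrt ((|n| : ℤ) / 2) with hm
  have hm0 : 0 ≤ m := Real.sqrt_nonneg _
  have hm2 : m ^ 2 = (|n| : ℤ) / 2 := Real.sq_sqrt (by positivity)
  have hv : 0 < |u - m| := abs_pos.2 (sub_ne_zero.2 hun)
  set X := ‖besselKernel δ n (u ^ 2)‖ ^ 4 with hX
  have hX0 : 0 ≤ X := by positivity
  have h1 : X ≤ 104 ^ 4 := by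
    have := norm_besselKernel_le hδ (sq_nonneg u) n
    rw [hX]
    gcongr
    linarith [Real.pi_lt_four]
  have h2 : X * (u ^ 3 * |u - m|) ≤ 104 ^ 4 := by
    refine le_trans ?_ (norm_besselKernel_pow_four_mul_le hδ (sq_nonneg u) n)
    have e : 2 * u ^ 2 - ((|n| : ℤ) : ℝ) = 2 * (u + m) * (u - m) := by
      have : ((|n| : ℤ) : ℝ) = 2 * m ^ 2 := by rw [hm2]; ring
      rw [this]; ring
    rw [e, abs_mul, abs_of_pos (by positivity : 0 < 2 * (u + m))]
    gcongr X * ?_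
    have : 0 ≤ u ^ 2 * |u - m| := by positivity
    nlinarith [mul_nonneg this hm0, mul_nonneg this hu0.le]
  have h3 := le_mul_rpow_of_mul_le (θ := 1 - ε / 4) (by norm_num) (by positivity) (by linarith)
    (by linarith) h1 h2
  have h4 : u ^ (1 - 2 * ε) ≤ u ^ (3 - 2 * ε) :=
    Real.rpow_le_rpow_of_exponent_le hu.le (by linarith)
  have h5 := rpow_mul_rpow_le_powerProfile hε (by linarith) hu hv
  rw [abs_of_pos hu0]
  calc _ ≤ (u ^ (3 - 2 * ε) + u ^ (3 - 2 * ε)) *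
        (104 ^ 4 * (u ^ 3 * |u - m|) ^ (-(1 - ε / 4))) := by gcongr
    _ = 2 * 104 ^ 4 * (u ^ (-(5 * ε / 4)) * |u - m| ^ (-(1 - ε / 4))) := by
        rw [Real.mul_rpow (by positivity) hv.le, ← Real.rpow_natCast u 3, ← Real.rpow_mul hu0.le]
        have : u ^ (-(5 * ε / 4)) = u ^ (3 - 2 * ε) * u ^ (((3 : ℕ) : ℝ) * -(1 - ε / 4)) := by
          rw [← Real.rpow_add hu0]; congr 1; push_cast; ring
        rw [this]; ring
    _ ≤ _ := by gcongr

/-- The weighted fourth power estimate, uniform in the order and in the damping. -/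
lemma exists_lintegral_besselKernel_le {ε : ℝ} (hε : 0 < ε) (hε2 : ε ≤ 1 / 2) :
    ∃ C : ℝ≥0∞, C ≠ ⊤ ∧ ∀ δ : ℝ, 0 ≤ δ → ∀ n : ℤ,
      ∫⁻ u in Set.Ioi (0 : ℝ), ENNReal.ofReal
        ((u ^ (3 - 2 * ε) + u ^ (1 - 2 * ε)) * ‖besselKernel δ n (u ^ 2)‖ ^ 4) ≤ C := by
  set K := ∫⁻ v : ℝ, ENNReal.ofReal (powerProfile ε |v|) with hK
  have hKtop : K ≠ ⊤ := by
    have := (integrable_powerProfile_abs hε).lintegral_lt_top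
    exact this.ne
  refine ⟨ENNReal.ofReal (2 * 104 ^ 4) + ENNReal.ofReal (2 * 104 ^ 4) * (K + K), ?_, ?_⟩
  · finiteness
  intro δ hδ n
  rw [← Set.Ioc_union_Ioi_eq_Ioi zero_le_one]
  refine (lintegral_union_le _ _ _).trans (add_le_add ?_ ?_)
  · calc _ ≤ ∫⁻ u in Set.Ioc (0 : ℝ) 1, ENNReal.ofReal (2 * 104 ^ 4) := by
          refine setLIntegral_mono' measurableSet_Ioc fun u hu => ?_
          gcongr
          · have := Real.rpow_le_one hu.1.le hu.2 (by linarith : 0 ≤ 3 - 2 * ε)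
            have := Real.rpow_le_one hu.1.le hu.2 (by linarith : 0 ≤ 1 - 2 * ε)
            linarith
          · have := norm_besselKernel_le hδ (sq_nonneg u) n
            linarith [Real.pi_lt_four]
      _ = _ := by simp
  · set m := Real.sqrt ((|n| : ℤ) / 2) with hm
    have hmeas : Measurable fun v : ℝ => ENNReal.ofReal (powerProfile ε |v|) := by
      unfold powerProfile
      refine ENNReal.measurable_ofReal.comp (Measurable.ite ?_ (by fun_prop) (by fun_prop))
      exact measurableSet_le (by fun_prop) (by fun_prop)
    calc _ ≤ ∫⁻ u in Set.Ioi (1 : ℝ), ENNReal.ofReal (2 * 104 ^ 4) *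
          (ENNReal.ofReal (powerProfile ε |u - m|) + ENNReal.ofReal (powerProfile ε |u|)) := by
          have hne : ∀ᵐ u ∂(volume : Measure ℝ), u ≠ m := by
            simp [ae_iff]
          refine setLIntegral_mono_ae' measurableSet_Ioi ?_
          filter_upwards [hne] with u hun hu
          rw [← ENNReal.ofReal_add (powerProfile_nonneg (abs_nonneg _))
            (powerProfile_nonneg (abs_nonneg _)), ← ENNReal.ofReal_mul (by norm_num)]
          exact ENNReal.ofReal_le_ofReal
            (weight_mul_norm_besselKernel_pow_four_le hε hε2 hδ n hu hun)
      _ ≤ ∫⁻ u, ENNReal.ofReal (2 * 104 ^ 4) *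
          (ENNReal.ofReal (powerProfile ε |u - m|) + ENNReal.ofReal (powerProfile ε |u|)) :=
          setLIntegral_le_lintegral _ _
      _ = _ := by
          rw [lintegral_const_mul' _ _ (by finiteness), lintegral_add_right _ hmeas,
            lintegral_sub_right_eq_self (fun v => ENNReal.ofReal (powerProfile ε |v|)) m]

/-- The inverse of `u ↦ α u - t / (2 u)` on the positive half line. -/
noncomputable def glasserInverse (α t w : ℝ) : ℝ := (w + √(w ^ 2 + 2 * t * α)) / (2 * α)

lemma hasDerivAt_glasserInverse {α t : ℝ} (hα : 0 < α) (ht : 0 < t) (w : ℝ) :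
    HasDerivAt (glasserInverse α t) ((1 + w / √(w ^ 2 + 2 * t * α)) / (2 * α)) w := by
  have hc : 0 < w ^ 2 + 2 * t * α := by positivity
  have h1 : HasDerivAt (fun w : ℝ => w ^ 2 + 2 * t * α) (2 * w) w := by
    refine ((hasDerivAt_pow 2 w).add_const (2 * t * α)).congr_deriv ?_
    simp
  refine (((hasDerivAt_id w).add (h1.sqrt hc.ne')).div_const (2 * α)).congr_deriv ?_
  have : √(w ^ 2 + 2 * t * α) ≠ 0 := (Real.sqrt_pos.2 hc).ne'
  field_simp

lemma abs_lt_sqrt_sq_add {w c : ℝ} (hc : 0 < c) : |w| < √(w ^ 2 + c) := by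
  rw [← Real.sqrt_sq_eq_abs]
  exact Real.sqrt_lt_sqrt (sq_nonneg w) (by linarith)

lemma glasserInverse_pos {α t : ℝ} (hα : 0 < α) (ht : 0 < t) (w : ℝ) :
    0 < glasserInverse α t w := by
  have h := abs_lt_sqrt_sq_add (w := w) (c := 2 * t * α) (by positivity)
  have := neg_abs_le w
  unfold glasserInverse
  exact div_pos (by linarith) (by positivity)

lemma glasserInverse_spec {α t : ℝ} (hα : 0 < α) (ht : 0 < t) (w : ℝ) :
    α * glasserInverse α t w - t / (2 * glasserInverse α t w) = w := by
  have hpos := glasserInverse_pos hα ht w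
  have hsq : √(w ^ 2 + 2 * t * α) ^ 2 = w ^ 2 + 2 * t * α := Real.sq_sqrt (by positivity)
  have key : α * glasserInverse α t w ^ 2 - w * glasserInverse α t w - t / 2 = 0 := by
    unfold glasserInverse
    generalize √(w ^ 2 + 2 * t * α) = s at hsq
    field_simp
    linear_combination hsq
  field_simp
  linarith

lemma glasserInverse_of_pos {α t u : ℝ} (hα : 0 < α) (ht : 0 < t) (hu : 0 < u) :
    glasserInverse α t (α * u - t / (2 * u)) = u := by
  have h : (α * u - t / (2 * u)) ^ 2 + 2 * t * α = (α * u + t / (2 * u)) ^ 2 := by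
    field_simp
    ring
  unfold glasserInverse
  rw [h, Real.sqrt_sq (by positivity)]
  field_simp
  ring

lemma glasserInverse_image {α t : ℝ} (hα : 0 < α) (ht : 0 < t) :
    glasserInverse α t '' Set.univ = Set.Ioi 0 := by
  ext u
  constructor
  · rintro ⟨w, -, rfl⟩
    exact glasserInverse_pos hα ht w
  · intro hu
    exact ⟨_, Set.mem_univ _, glasserInverse_of_pos hα ht hu⟩

/-- A Gaussian integral in the variable `α u - t / (2 u)` (Glasser's master theorem). -/
lemma integral_cexp_glasser {α t : ℝ} (hα : 0 < α) (ht : 0 < t) {z : ℂ} (hz : z.re < 0) :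
    ∫ u in Set.Ioi (0 : ℝ), cexp (z * ((α * u - t / (2 * u)) ^ 2 : ℝ)) =
      ((1 / (2 * α) : ℝ) : ℂ) * (Real.pi / -z) ^ (1 / 2 : ℂ) := by
  have hinj : Set.InjOn (glasserInverse α t) Set.univ := by
    intro a _ b _ h
    rw [← glasserInverse_spec hα ht a, ← glasserInverse_spec hα ht b, h]
  have hint : Integrable fun w : ℝ => cexp (z * (w ^ 2 : ℝ)) := by
    have := integrable_cexp_neg_mul_sq (b := -z) (by simpa using hz)
    simpa using this
  have hodd : ∫ w : ℝ, ((w / √(w ^ 2 + 2 * t * α) : ℝ) : ℂ) * cexp (z * (w ^ 2 : ℝ)) = 0 := by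
    have h := integral_neg_eq_self
      (fun w : ℝ => ((w / √(w ^ 2 + 2 * t * α) : ℝ) : ℂ) * cexp (z * (w ^ 2 : ℝ))) volume
    simp only [neg_sq, neg_div, ofReal_neg, neg_mul, integral_neg] at h
    exact self_eq_neg.1 h.symm
  have hoddint : Integrable fun w : ℝ =>
      ((w / √(w ^ 2 + 2 * t * α) : ℝ) : ℂ) * cexp (z * (w ^ 2 : ℝ)) := by
    refine hint.bdd_mul (c := 1)
      (Complex.measurable_ofReal.comp (by fun_prop)).aestronglyMeasurable (.of_forall fun w => ?_)
    rw [norm_real, Real.norm_eq_abs, abs_div, abs_of_nonneg (Real.sqrt_nonneg _)]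
    exact div_le_one_of_le₀ (abs_lt_sqrt_sq_add (by positivity)).le (Real.sqrt_nonneg _)
  rw [← glasserInverse_image hα ht, integral_image_eq_integral_abs_deriv_smul MeasurableSet.univ
    (fun w _ => (hasDerivAt_glasserInverse hα ht w).hasDerivWithinAt) hinj, setIntegral_univ]
  have heq : ∀ w : ℝ, |(1 + w / √(w ^ 2 + 2 * t * α)) / (2 * α)| •
      cexp (z * ((α * glasserInverse α t w - t / (2 * glasserInverse α t w)) ^ 2 : ℝ)) =
      ((1 / (2 * α) : ℝ) : ℂ) * (cexp (z * (w ^ 2 : ℝ)) +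
        ((w / √(w ^ 2 + 2 * t * α) : ℝ) : ℂ) * cexp (z * (w ^ 2 : ℝ))) := by
    intro w
    have h1 : |w / √(w ^ 2 + 2 * t * α)| ≤ 1 := by
      rw [abs_div, abs_of_nonneg (Real.sqrt_nonneg _)]
      exact div_le_one_of_le₀ (abs_lt_sqrt_sq_add (by positivity)).le (Real.sqrt_nonneg _)
    have h2 := neg_abs_le (w / √(w ^ 2 + 2 * t * α))
    rw [glasserInverse_spec hα ht, abs_of_nonneg (div_nonneg (by linarith) (by positivity)),
      real_smul]
    push_cast
    ring
  simp_rw [heq]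
  rw [integral_const_mul, integral_add hint hoddint, hodd, add_zero]
  congr 1
  have := integral_gaussian_complex (b := -z) (by simpa using hz)
  rw [← this]
  simp

/-- The phase of the subordination formula. -/
noncomputable def subordPhase (t lam u : ℝ) : ℝ := lam * u ^ 2 + t ^ 2 / (4 * u ^ 2)

/-- The leading weight produced by integrating by parts in the subordination formula. -/
noncomputable def subordWeight (t u : ℝ) : ℝ := u ^ 4 / (t ^ 2 + u ^ 4)

/-- The derivative of `u ^ 3 / (t ^ 2 + u ^ 4)`. -/
noncomputable def subordCorrection (t u : ℝ) : ℝ :=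
  (3 * u ^ 2 * t ^ 2 - u ^ 6) / (t ^ 2 + u ^ 4) ^ 2

@[fun_prop]
lemma measurable_subordPhase (t lam : ℝ) : Measurable (subordPhase t lam) := by
  unfold subordPhase; fun_prop

@[fun_prop]
lemma measurable_subordWeight (t : ℝ) : Measurable (subordWeight t) := by
  unfold subordWeight; fun_prop

@[fun_prop]
lemma measurable_subordCorrection (t : ℝ) : Measurable (subordCorrection t) := by
  unfold subordCorrection; fun_prop

lemma subordWeight_nonneg (t u : ℝ) : 0 ≤ subordWeight t u := by
  unfold subordWeight; positivity

lemma subordWeight_le_one (t u : ℝ) : subordWeight t u ≤ 1 :=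
  div_le_one_of_le₀ (by nlinarith [sq_nonneg t]) (by positivity)

lemma abs_subordCorrection_le {t : ℝ} (ht : 0 < t) (u : ℝ) :
    |subordCorrection t u| ≤ 3 * (u ^ 2 / (t ^ 2 + u ^ 4)) := by
  have h : 0 < t ^ 2 + u ^ 4 := by positivity
  rw [subordCorrection, abs_div, abs_of_pos (pow_pos h 2), div_le_iff₀ (by positivity), abs_le]
  have e : 3 * (u ^ 2 / (t ^ 2 + u ^ 4)) * (t ^ 2 + u ^ 4) ^ 2 = 3 * u ^ 2 * (t ^ 2 + u ^ 4) := by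
    field_simp
  rw [e]
  have h1 : 0 ≤ u ^ 2 * t ^ 2 := by positivity
  have h2 : 0 ≤ u ^ 6 := by positivity
  constructor <;> nlinarith

lemma sq_div_le {t : ℝ} (ht : 0 < t) (u : ℝ) : u ^ 2 / (t ^ 2 + u ^ 4) ≤ 1 / t := by
  rw [div_le_div_iff₀ (by positivity) ht]
  nlinarith [sq_nonneg (t - u ^ 2), mul_nonneg ht.le (sq_nonneg u), sq_nonneg t]

lemma norm_cexp_mul_subordPhase_le {t lam : ℝ} {z : ℂ} (hz : z.re < 0) (u : ℝ) :
    ‖cexp (z * (subordPhase t lam u : ℝ))‖ ≤ Real.exp (z.re * (lam * u ^ 2)) := by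
  rw [norm_exp, re_mul_ofReal, subordPhase]
  refine Real.exp_le_exp.2 (mul_le_mul_of_nonpos_left ?_ hz.le)
  have : 0 ≤ t ^ 2 / (4 * u ^ 2) := by positivity
  linarith

lemma integrable_exp_re_mul {lam : ℝ} (hlam : 0 < lam) {r : ℝ} (hr : r < 0) :
    Integrable fun u : ℝ => Real.exp (r * (lam * u ^ 2)) := by
  have := integrable_exp_neg_mul_sq (b := -r * lam) (by nlinarith)
  refine this.congr (.of_forall fun u => ?_)
  simp only
  ring_nf

lemma integrable_cexp_mul_subordPhase {t lam : ℝ} (hlam : 0 < lam) {z : ℂ} (hz : z.re < 0) :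
    Integrable fun u : ℝ => cexp (z * (subordPhase t lam u : ℝ)) :=
  (integrable_exp_re_mul hlam hz).mono'
    (Complex.measurable_exp.comp (measurable_const.mul
      (Complex.measurable_ofReal.comp (measurable_subordPhase t lam)))).aestronglyMeasurable
    (.of_forall (norm_cexp_mul_subordPhase_le hz))

lemma hasDerivAt_subord {t lam : ℝ} (ht : 0 < t) {z : ℂ} (hz : z ≠ 0) {u : ℝ} (hu : 0 < u) :
    HasDerivAt (fun u : ℝ => ((u ^ 3 / (t ^ 2 + u ^ 4) : ℝ) : ℂ) *
        cexp (z * (subordPhase t lam u : ℝ)))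
      (z / 2 * ((((1 + 4 * lam) * subordWeight t u : ℝ) + 2 / z * (subordCorrection t u : ℝ)) *
        cexp (z * (subordPhase t lam u : ℝ)) - cexp (z * (subordPhase t lam u : ℝ)))) u := by
  have h0 : t ^ 2 + u ^ 4 ≠ 0 := by positivity
  have hden : HasDerivAt (fun u : ℝ => t ^ 2 + u ^ 4) (4 * u ^ 3) u :=
    ((hasDerivAt_pow 4 u).const_add (t ^ 2)).congr_deriv (by norm_num)
  have h1 : HasDerivAt (fun u : ℝ => u ^ 3 / (t ^ 2 + u ^ 4)) (subordCorrection t u) u := by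
    refine ((hasDerivAt_pow 3 u).div hden h0).congr_deriv ?_
    unfold subordCorrection
    congr 1
    push_cast
    ring
  have h2 : HasDerivAt (subordPhase t lam) (2 * lam * u - t ^ 2 / (2 * u ^ 3)) u := by
    have hq : HasDerivAt (fun u : ℝ => 4 * u ^ 2) (8 * u) u :=
      ((hasDerivAt_pow 2 u).const_mul 4).congr_deriv (by push_cast; ring)
    refine (((hasDerivAt_pow 2 u).const_mul lam).add
      ((hasDerivAt_const u (t ^ 2)).div hq (by positivity))).congr_deriv ?_
    field_simp
    push_cast
    ring
  refine (h1.ofReal_comp.mul ((h2.ofReal_comp.const_mul z).cexp)).congr_deriv ?_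
  have hc : (u ^ 3 / (t ^ 2 + u ^ 4)) * (2 * lam * u - t ^ 2 / (2 * u ^ 3)) =
      ((1 + 4 * lam) * subordWeight t u - 1) / 2 := by
    unfold subordWeight
    field_simp
    ring
  have hc' : ((u ^ 3 / (t ^ 2 + u ^ 4) : ℝ) : ℂ) * ((2 * lam * u - t ^ 2 / (2 * u ^ 3) : ℝ) : ℂ) =
      ((((1 + 4 * lam) * subordWeight t u : ℝ) : ℂ) - 1) / 2 := by exact_mod_cast hc
  have hz' : z / 2 * (2 / z) = 1 := by field_simp
  linear_combination cexp (z * (subordPhase t lam u : ℝ)) * z * hc' -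
    cexp (z * (subordPhase t lam u : ℝ)) * (subordCorrection t u : ℂ) * hz'

lemma norm_subord_weight_le {t lam : ℝ} (ht : 0 < t) (hlam : 0 ≤ lam) {z : ℂ} (u : ℝ) :
    ‖(((1 + 4 * lam) * subordWeight t u : ℝ) : ℂ) + 2 / z * (subordCorrection t u : ℝ)‖ ≤
      (1 + 4 * lam) + 2 / ‖z‖ * (3 * (1 / t)) := by
  refine (norm_add_le _ _).trans (add_le_add ?_ ?_)
  · rw [norm_real, Real.norm_eq_abs, abs_of_nonneg (mul_nonneg (by positivity)
      (subordWeight_nonneg t u))]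
    exact mul_le_of_le_one_right (by positivity) (subordWeight_le_one t u)
  · rw [norm_mul, norm_div, norm_real, Real.norm_eq_abs, RCLike.norm_ofNat]
    refine mul_le_mul_of_nonneg_left ((abs_subordCorrection_le ht u).trans ?_) (by positivity)
    exact mul_le_mul_of_nonneg_left (sq_div_le ht u) (by norm_num)

lemma integrable_subord {t lam : ℝ} (ht : 0 < t) (hlam : 0 < lam) {z : ℂ} (hz : z.re < 0) :
    Integrable fun u : ℝ =>
      ((((1 + 4 * lam) * subordWeight t u : ℝ) : ℂ) + 2 / z * (subordCorrection t u : ℝ)) *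
        cexp (z * (subordPhase t lam u : ℝ)) := by
  refine (integrable_cexp_mul_subordPhase hlam hz).bdd_mul ?_ (.of_forall
    fun u => norm_subord_weight_le ht hlam.le u)
  exact ((Complex.measurable_ofReal.comp ((measurable_subordWeight t).const_mul _)).add
    ((Complex.measurable_ofReal.comp (measurable_subordCorrection t)).const_mul
      _)).aestronglyMeasurable

lemma integral_subord {t lam : ℝ} (ht : 0 < t) (hlam : 0 < lam) {z : ℂ} (hz : z.re < 0) :
    ∫ u in Set.Ioi (0 : ℝ),
      ((((1 + 4 * lam) * subordWeight t u : ℝ) : ℂ) + 2 / z * (subordCorrection t u : ℝ)) *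
        cexp (z * (subordPhase t lam u : ℝ)) =
      cexp (z * (t * √lam : ℝ)) * (((1 / (2 * √lam) : ℝ) : ℂ) * (Real.pi / -z) ^ (1 / 2 : ℂ)) := by
  have hz0 : z ≠ 0 := by rintro rfl; simp at hz
  have hw := (integrable_subord ht hlam hz).integrableOn (s := Set.Ioi 0)
  have he := (integrable_cexp_mul_subordPhase (t := t) hlam hz).integrableOn (s := Set.Ioi 0)
  have hle : ∀ u : ℝ, ‖cexp (z * (subordPhase t lam u : ℝ))‖ ≤ 1 := fun u =>
    (norm_cexp_mul_subordPhase_le hz u).trans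
      (Real.exp_le_one_iff.2 (mul_nonpos_of_nonpos_of_nonneg hz.le (by positivity)))
  have hQ : ∀ u : ℝ, 0 ≤ u → ‖((u ^ 3 / (t ^ 2 + u ^ 4) : ℝ) : ℂ) *
      cexp (z * (subordPhase t lam u : ℝ))‖ ≤ u ^ 3 / (t ^ 2 + u ^ 4) := by
    intro u hu
    rw [norm_mul, norm_real, Real.norm_eq_abs, abs_of_nonneg (by positivity)]
    exact mul_le_of_le_one_right (by positivity) (hle u)
  have hparts := integral_Ioi_of_hasDerivAt_of_tendsto
    (f := fun u : ℝ => ((u ^ 3 / (t ^ 2 + u ^ 4) : ℝ) : ℂ) *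
      cexp (z * (subordPhase t lam u : ℝ))) (a := 0) (m := 0) ?_
    (fun u hu => hasDerivAt_subord ht hz0 hu) ((hw.sub he).const_mul _) ?_
  · rw [integral_const_mul, integral_sub hw he] at hparts
    have : z / 2 ≠ 0 := by simpa using hz0
    simp only [ne_eq, OfNat.ofNat_ne_zero, not_false_eq_true, zero_pow, zero_div,
      Complex.ofReal_zero, zero_mul, sub_zero, mul_eq_zero, this, false_or, sub_eq_zero] at hparts
    refine hparts.trans ?_
    rw [ ← integral_cexp_glasser (Real.sqrt_pos.2 hlam) ht hz, ← integral_const_mul]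
    refine setIntegral_congr_fun measurableSet_Ioi fun u hu => ?_
    have hu : 0 < u := hu
    rw [← Complex.exp_add, ← mul_add, ← Complex.ofReal_add]
    congr 3
    have hs := Real.sq_sqrt hlam.le
    unfold subordPhase
    field_simp
    linear_combination (-16 * u ^ 4) * hs
  · have h0 : Filter.Tendsto (fun u : ℝ => u ^ 3 / (t ^ 2 + u ^ 4)) (nhdsWithin 0 (Set.Ici 0))
        (nhds 0) := by
      have : Continuous fun u : ℝ => u ^ 3 / (t ^ 2 + u ^ 4) :=
        (continuous_pow 3).div₀ (by fun_prop) fun u => by positivity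
      have h := this.tendsto 0
      simp only [ne_eq, OfNat.ofNat_ne_zero, not_false_eq_true, zero_pow, zero_div] at h
      exact h.mono_left nhdsWithin_le_nhds
    have h1 : Filter.Tendsto (fun u : ℝ => ((u ^ 3 / (t ^ 2 + u ^ 4) : ℝ) : ℂ) *
        cexp (z * (subordPhase t lam u : ℝ))) (nhdsWithin 0 (Set.Ici 0)) (nhds 0) :=
      squeeze_zero_norm' (eventually_nhdsWithin_of_forall fun u hu => hQ u hu) h0
    rw [ContinuousWithinAt]
    simpa using h1
  · refine squeeze_zero_norm' (a := fun u : ℝ => u⁻¹) ?_ tendsto_inv_atTop_zero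
    filter_upwards [Filter.eventually_gt_atTop 0] with u hu
    refine (hQ u hu.le).trans ?_
    rw [← one_div, div_le_div_iff₀ (by positivity) hu]
    nlinarith [sq_nonneg t]

lemma restrict_torusBox (d : ℕ) : (volume : Measure (Fin d → ℝ)).restrict (torusBox d) =
    Measure.pi fun _ => volume.restrict (Set.Icc (-Real.pi) Real.pi) := by
  rw [torusBox, volume_pi, Measure.restrict_pi_pi]

instance isFiniteMeasure_restrict_torusBox (d : ℕ) :
    IsFiniteMeasure ((volume : Measure (Fin d → ℝ)).restrict (torusBox d)) := by
  rw [restrict_torusBox]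
  infer_instance

/-- The symbol of the discrete Laplacian, `∑ (2 - 2 cos ξ_j)`. -/
noncomputable def latticeSymbol (d : ℕ) (ξ : Fin d → ℝ) : ℝ := ∑ j, (2 - 2 * Real.cos (ξ j))

lemma discOmega_eq (d : ℕ) (ξ : Fin d → ℝ) : discOmega d ξ = √(latticeSymbol d ξ) := rfl

lemma latticeSymbol_nonneg (d : ℕ) (ξ : Fin d → ℝ) : 0 ≤ latticeSymbol d ξ :=
  Finset.sum_nonneg fun j _ => by linarith [Real.cos_le_one (ξ j)]

lemma continuous_latticeSymbol (d : ℕ) : Continuous (latticeSymbol d) := by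
  unfold latticeSymbol; fun_prop

lemma discOmega_sq (d : ℕ) (ξ : Fin d → ℝ) : discOmega d ξ ^ 2 = latticeSymbol d ξ :=
  Real.sq_sqrt (latticeSymbol_nonneg d ξ)

lemma measurable_discOmega (d : ℕ) : Measurable (discOmega d) :=
  (continuous_latticeSymbol d).sqrt.measurable

lemma latticeSymbol_pos {d : ℕ} [NeZero d] {ξ : Fin d → ℝ} (hξ : ξ ∈ torusBox d)
    (h : ∀ j, ξ j ≠ 0) : 0 < latticeSymbol d ξ := by
  refine Finset.sum_pos (fun j _ => ?_) ⟨0, Finset.mem_univ _⟩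
  have h1 := Real.cos_le_one_sub_mul_cos_sq (abs_le.2 (hξ j (Set.mem_univ j)))
  have : 0 < 2 / Real.pi ^ 2 * ξ j ^ 2 := by have := h j; positivity
  linarith

lemma ae_restrict_torusBox_ne_zero (d : ℕ) :
    ∀ᵐ ξ ∂(volume : Measure (Fin d → ℝ)).restrict (torusBox d), ξ ∈ torusBox d ∧ ∀ j, ξ j ≠ 0 := by
  have hm : MeasurableSet (torusBox d) := MeasurableSet.univ_pi fun _ => measurableSet_Icc
  refine (ae_restrict_mem hm).and (ae_all_iff.2 fun j => ae_restrict_of_ae ?_)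
  rw [volume_pi]
  exact Measure.ae_eval_ne _ j 0

lemma ae_latticeSymbol_pos (d : ℕ) [NeZero d] :
    ∀ᵐ ξ ∂(volume : Measure (Fin d → ℝ)).restrict (torusBox d), 0 < latticeSymbol d ξ := by
  filter_upwards [ae_restrict_torusBox_ne_zero d] with ξ h using latticeSymbol_pos h.1 h.2

lemma integrableOn_abs_rpow_neg_half :
    IntegrableOn (fun r : ℝ => |r| ^ (-(1 / 2) : ℝ)) (Set.Icc (-Real.pi) Real.pi) := by
  have h1 : IntegrableOn ((Set.Ioc 0 Real.pi).indicator fun r : ℝ => r ^ (-(1 / 2) : ℝ))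
      (Set.Ioi 0) := by
    refine ((integrable_indicator_iff measurableSet_Ioc).2 ?_).integrableOn
    rw [← intervalIntegrable_iff_integrableOn_Ioc_of_le Real.pi_pos.le]
    exact intervalIntegral.intervalIntegrable_rpow' (by norm_num)
  refine ((integrable_comp_abs_of_integrableOn h1).integrableOn
    (s := Set.Icc (-Real.pi) Real.pi)).congr_fun (fun r hr => ?_) measurableSet_Icc
  have hr' := abs_le.2 hr
  rcases (abs_nonneg r).eq_or_lt with h0 | h0
  · simp [← h0]
  · simp [h0, hr']

lemma one_div_latticeSymbol_le {ξ : Fin 4 → ℝ} (hξ : ξ ∈ torusBox 4) (h : ∀ j, ξ j ≠ 0) :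
    1 / latticeSymbol 4 ξ ≤ Real.pi ^ 2 / 16 * ∏ j, |ξ j| ^ (-(1 / 2) : ℝ) := by
  have hlow : 4 / Real.pi ^ 2 * ∑ j, ξ j ^ 2 ≤ latticeSymbol 4 ξ := by
    rw [latticeSymbol, Finset.mul_sum]
    refine Finset.sum_le_sum fun j _ => ?_
    have := Real.cos_le_one_sub_mul_cos_sq (abs_le.2 (hξ j (Set.mem_univ j)))
    have e : 4 / Real.pi ^ 2 * ξ j ^ 2 = 2 * (2 / Real.pi ^ 2 * ξ j ^ 2) := by ring
    linarith
  have hamgm := Real.geom_mean_le_arith_mean4_weighted (w₁ := 1 / 4) (w₂ := 1 / 4) (w₃ := 1 / 4)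
    (w₄ := 1 / 4) (by norm_num) (by norm_num) (by norm_num) (by norm_num) (sq_nonneg (ξ 0))
    (sq_nonneg (ξ 1)) (sq_nonneg (ξ 2)) (sq_nonneg (ξ 3)) (by norm_num)
  have hr : ∀ r : ℝ, (r ^ 2) ^ (1 / 4 : ℝ) = |r| ^ (1 / 2 : ℝ) := fun r => by
    rw [← sq_abs, ← Real.rpow_natCast, ← Real.rpow_mul (abs_nonneg r)]; norm_num
  have hprod : ∏ j, |ξ j| ^ (1 / 2 : ℝ) ≤ 1 / 4 * ∑ j, ξ j ^ 2 := by
    simp only [hr] at hamgm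
    simp only [Fin.prod_univ_four, Fin.sum_univ_four]
    linarith
  have hpos : 0 < ∏ j, |ξ j| ^ (1 / 2 : ℝ) :=
    Finset.prod_pos fun j _ => Real.rpow_pos_of_pos (abs_pos.2 (h j)) _
  have hinv : ∏ j, |ξ j| ^ (-(1 / 2) : ℝ) = (∏ j, |ξ j| ^ (1 / 2 : ℝ))⁻¹ := by
    rw [← Finset.prod_inv_distrib]
    exact Finset.prod_congr rfl fun j _ => Real.rpow_neg (abs_nonneg _) _
  rw [hinv, ← div_eq_mul_inv, div_le_div_iff₀ (latticeSymbol_pos hξ h) hpos, one_mul]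
  calc ∏ j, |ξ j| ^ (1 / 2 : ℝ) ≤ 1 / 4 * ∑ j, ξ j ^ 2 := hprod
    _ = Real.pi ^ 2 / 16 * (4 / Real.pi ^ 2 * ∑ j, ξ j ^ 2) := by field_simp; ring
    _ ≤ _ := by gcongr

lemma integrable_one_div_latticeSymbol :
    IntegrableOn (fun ξ => 1 / latticeSymbol 4 ξ) (torusBox 4) := by
  have h : Integrable (fun ξ : Fin 4 → ℝ => Real.pi ^ 2 / 16 * ∏ j, |ξ j| ^ (-(1 / 2) : ℝ))
      (volume.restrict (torusBox 4)) := by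
    rw [restrict_torusBox]
    exact (Integrable.fintype_prod (f := fun _ r => |r| ^ (-(1 / 2) : ℝ))
      fun _ => integrableOn_abs_rpow_neg_half).const_mul _
  refine h.mono' (measurable_const.div
    (continuous_latticeSymbol 4).measurable).aestronglyMeasurable ?_
  filter_upwards [ae_restrict_torusBox_ne_zero 4] with ξ hξ
  rw [Real.norm_eq_abs, abs_of_nonneg (div_nonneg zero_le_one (latticeSymbol_nonneg 4 ξ))]
  exact one_div_latticeSymbol_le hξ.1 hξ.2

lemma integrable_one_div_discOmega :
    IntegrableOn (fun ξ => 1 / discOmega 4 ξ) (torusBox 4) := by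
  refine (integrable_one_div_latticeSymbol.add (integrable_const 1)).mono'
    (measurable_const.div (measurable_discOmega 4)).aestronglyMeasurable (.of_forall fun ξ => ?_)
  have h0 : 0 ≤ 1 / discOmega 4 ξ := div_nonneg zero_le_one (Real.sqrt_nonneg _)
  rw [Real.norm_eq_abs, abs_of_nonneg h0, Pi.add_apply, ← discOmega_sq, ← one_div_pow]
  nlinarith [sq_nonneg (1 / discOmega 4 ξ - 1)]

/-- The character `ξ ↦ exp (i x · ξ)`. -/
noncomputable def latticeChar {d : ℕ} (x : Fin d → ℤ) (ξ : Fin d → ℝ) : ℂ :=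
  cexp (I * ((∑ j, (x j : ℝ) * ξ j : ℝ) : ℂ))

/-- The lattice Schrödinger-type kernel, a product of one-dimensional kernels. -/
noncomputable def latticeKernel {d : ℕ} (δ : ℝ) (x : Fin d → ℤ) (σ : ℝ) : ℂ :=
  ∏ j, besselKernel δ (x j) σ

lemma norm_latticeChar {d : ℕ} (x : Fin d → ℤ) (ξ : Fin d → ℝ) : ‖latticeChar x ξ‖ = 1 := by
  rw [latticeChar, mul_comm, norm_exp_ofReal_mul_I]

lemma continuous_latticeChar {d : ℕ} (x : Fin d → ℤ) : Continuous (latticeChar x) := by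
  unfold latticeChar; fun_prop

lemma latticeChar_add_single {d : ℕ} (x : Fin d → ℤ) (j : Fin d) (ξ : Fin d → ℝ) :
    latticeChar (x + Pi.single j 1) ξ = latticeChar x ξ * cexp (ξ j * I) := by
  have : ∑ i, ((x + Pi.single j 1 : Fin d → ℤ) i : ℝ) * ξ i = ∑ i, (x i : ℝ) * ξ i + ξ j := by
    simp [add_mul, Finset.sum_add_distrib, Pi.single_apply]
  rw [latticeChar, latticeChar, this, ← Complex.exp_add]
  push_cast
  ring_nf

lemma latticeChar_sub_single {d : ℕ} (x : Fin d → ℤ) (j : Fin d) (ξ : Fin d → ℝ) :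
    latticeChar (x - Pi.single j 1) ξ = latticeChar x ξ * cexp (-ξ j * I) := by
  have h := latticeChar_add_single (x - Pi.single j 1) j ξ
  rw [sub_add_cancel] at h
  rw [h, mul_assoc, ← Complex.exp_add]
  simp

lemma latticeChar_mul_two_cos {d : ℕ} (x : Fin d → ℤ) (j : Fin d) (ξ : Fin d → ℝ) :
    latticeChar x ξ * (2 * Real.cos (ξ j) : ℝ) =
      latticeChar (x + Pi.single j 1) ξ + latticeChar (x - Pi.single j 1) ξ := by
  rw [latticeChar_add_single, latticeChar_sub_single, ← mul_add, Complex.ofReal_mul, ofReal_cos,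
    Complex.ofReal_ofNat, two_cos]

lemma integral_latticeChar_mul_exp {d : ℕ} (δ : ℝ) (x : Fin d → ℤ) (σ : ℝ) :
    ∫ ξ in torusBox d, latticeChar x ξ * cexp ((I - δ) * σ * (latticeSymbol d ξ : ℝ)) =
      latticeKernel δ x σ := by
  have h : ∀ ξ : Fin d → ℝ, latticeChar x ξ * cexp ((I - δ) * σ * (latticeSymbol d ξ : ℝ)) =
      ∏ j, cexp (I * (x j * ξ j : ℝ)) * cexp ((I - δ) * σ * (2 - 2 * Real.cos (ξ j) : ℝ)) := by
    intro ξ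
    rw [Finset.prod_mul_distrib, ← Complex.exp_sum, ← Complex.exp_sum, ← Finset.mul_sum,
      ← Finset.mul_sum, ← Complex.ofReal_sum, ← Complex.ofReal_sum, latticeChar, latticeSymbol]
  simp_rw [h]
  rw [restrict_torusBox, integral_fintype_prod_eq_prod
    (f := fun j r => cexp (I * (x j * r : ℝ)) * cexp ((I - δ) * σ * (2 - 2 * Real.cos r : ℝ)))]
  rfl

lemma isCompact_torusBox (d : ℕ) : IsCompact (torusBox d) :=
  isCompact_univ_pi fun _ => isCompact_Icc

lemma integrable_latticeChar_mul_exp {d : ℕ} (δ : ℝ) (x : Fin d → ℤ) (σ : ℝ) :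
    IntegrableOn (fun ξ => latticeChar x ξ * cexp ((I - δ) * σ * (latticeSymbol d ξ : ℝ)))
      (torusBox d) := by
  have := continuous_latticeSymbol d
  have := continuous_latticeChar x
  exact (Continuous.continuousOn (by fun_prop)).integrableOn_compact (isCompact_torusBox d)

lemma integral_symbol_mul_latticeChar_mul_exp (δ : ℝ) (x : Fin 4 → ℤ) (σ : ℝ) :
    ∫ ξ in torusBox 4, ((1 + 4 * latticeSymbol 4 ξ : ℝ) : ℂ) *
        (latticeChar x ξ * cexp ((I - δ) * σ * (latticeSymbol 4 ξ : ℝ))) =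
      33 * latticeKernel δ x σ - 4 * ∑ j, (latticeKernel δ (x + Pi.single j 1) σ +
        latticeKernel δ (x - Pi.single j 1) σ) := by
  have h : ∀ ξ : Fin 4 → ℝ, ((1 + 4 * latticeSymbol 4 ξ : ℝ) : ℂ) *
        (latticeChar x ξ * cexp ((I - δ) * σ * (latticeSymbol 4 ξ : ℝ))) =
      33 * (latticeChar x ξ * cexp ((I - δ) * σ * (latticeSymbol 4 ξ : ℝ))) - 4 * ∑ j,
        (latticeChar (x + Pi.single j 1) ξ * cexp ((I - δ) * σ * (latticeSymbol 4 ξ : ℝ)) +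
        latticeChar (x - Pi.single j 1) ξ * cexp ((I - δ) * σ * (latticeSymbol 4 ξ : ℝ))) := by
    intro ξ
    simp_rw [← add_mul, ← latticeChar_mul_two_cos]
    have e : ((1 + 4 * latticeSymbol 4 ξ : ℝ) : ℂ) =
        33 - 4 * ∑ j, ((2 * Real.cos (ξ j) : ℝ) : ℂ) := by
      rw [latticeSymbol, Fin.sum_univ_four, Fin.sum_univ_four]
      push_cast
      ring
    rw [e, ← Finset.sum_mul, ← Finset.mul_sum]
    ring
  have hi := fun y => integrable_latticeChar_mul_exp δ (y : Fin 4 → ℤ) σ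
  have hadd : ∀ j ∈ Finset.univ, IntegrableOn (fun ξ =>
      latticeChar (x + Pi.single j 1) ξ * cexp ((I - δ) * σ * (latticeSymbol 4 ξ : ℝ)) +
      latticeChar (x - Pi.single j 1) ξ * cexp ((I - δ) * σ * (latticeSymbol 4 ξ : ℝ)))
      (torusBox 4) := fun j _ => (hi _).add (hi _)
  simp_rw [h]
  rw [integral_sub ((hi x).const_mul _) ((integrable_finsetSum _ hadd).const_mul _),
    integral_const_mul, integral_const_mul, integral_finsetSum _ hadd, integral_latticeChar_mul_exp]
  simp_rw [integral_add (hi _) (hi _), integral_latticeChar_mul_exp]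

lemma measurable_besselKernel (δ : ℝ) (n : ℤ) : Measurable (besselKernel δ n) := by
  have hc : Continuous fun p : ℝ × ℝ => cexp (I * (n * p.2 : ℝ)) *
      cexp ((I - δ) * p.1 * (2 - 2 * Real.cos p.2 : ℝ)) := by fun_prop
  exact (hc.stronglyMeasurable.integral_prod_right
    (ν := volume.restrict (Set.Icc (-Real.pi) Real.pi))).measurable

lemma measurable_latticeKernel {d : ℕ} (δ : ℝ) (x : Fin d → ℤ) : Measurable (latticeKernel δ x) :=
  Finset.measurable_prod _ fun j _ => measurable_besselKernel δ (x j)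

lemma norm_latticeKernel_le (δ : ℝ) (x : Fin 4 → ℤ) (σ : ℝ) :
    ‖latticeKernel δ x σ‖ ≤ ∑ j, ‖besselKernel δ (x j) σ‖ ^ 4 := by
  rw [latticeKernel, norm_prod, Fin.prod_univ_four, Fin.sum_univ_four]
  generalize ‖besselKernel δ (x 0) σ‖ = a
  generalize ‖besselKernel δ (x 1) σ‖ = b
  generalize ‖besselKernel δ (x 2) σ‖ = c
  generalize ‖besselKernel δ (x 3) σ‖ = e
  nlinarith [sq_nonneg (a * b - c * e), sq_nonneg (a ^ 2 - b ^ 2), sq_nonneg (c ^ 2 - e ^ 2),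
    sq_nonneg (a ^ 2), sq_nonneg (b ^ 2), sq_nonneg (c ^ 2), sq_nonneg (e ^ 2)]

lemma rpow_mul_rpow_le_add {t u θ : ℝ} (ht : 0 ≤ t) (hu : 0 ≤ u) (h0 : 0 ≤ θ) (h1 : θ ≤ 1) :
    t ^ (2 * θ) * u ^ (4 * (1 - θ)) ≤ t ^ 2 + u ^ 4 := by
  have h := Real.geom_mean_le_arith_mean2_weighted h0 (sub_nonneg.2 h1) (sq_nonneg t)
    (show 0 ≤ u ^ 4 by positivity) (by ring)
  rw [← Real.rpow_natCast, ← Real.rpow_natCast, ← Real.rpow_mul ht, ← Real.rpow_mul hu] at h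
  push_cast at h
  refine h.trans ?_
  rw [Real.rpow_ofNat, Real.rpow_ofNat]
  have : 0 ≤ t ^ 2 := by positivity
  have : 0 ≤ u ^ 4 := by positivity
  nlinarith

lemma weight_le {ε t u : ℝ} (hε : 0 < ε) (hε2 : ε ≤ 1 / 2) (ht : 0 < t) (hu : 0 < u) :
    (u ^ 4 + u ^ 2) / (t ^ 2 + u ^ 4) ≤
      t ^ (-(3 / 2) + ε) * (u ^ (3 - 2 * ε) + u ^ (1 - 2 * ε)) := by
  have h := rpow_mul_rpow_le_add (θ := 3 / 4 - ε / 2) ht.le hu.le (by linarith) (by linarith)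
  rw [div_le_iff₀ (by positivity)]
  have e1 : t ^ (-(3 / 2) + ε) * t ^ (2 * (3 / 4 - ε / 2)) = 1 := by
    rw [← Real.rpow_add ht]
    ring_nf
    exact Real.rpow_zero t
  have e2 : u ^ (3 - 2 * ε) * u ^ (4 * (1 - (3 / 4 - ε / 2))) = u ^ 4 := by
    rw [← Real.rpow_add hu, ← Real.rpow_natCast]
    congr 1
    push_cast
    ring
  have e3 : u ^ (1 - 2 * ε) * u ^ (4 * (1 - (3 / 4 - ε / 2))) = u ^ 2 := by
    rw [← Real.rpow_add hu, ← Real.rpow_natCast]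
    congr 1
    push_cast
    ring
  calc u ^ 4 + u ^ 2 = t ^ (-(3 / 2) + ε) * (u ^ (3 - 2 * ε) + u ^ (1 - 2 * ε)) *
        (t ^ (2 * (3 / 4 - ε / 2)) * u ^ (4 * (1 - (3 / 4 - ε / 2)))) := by
        rw [← e2, ← e3]
        linear_combination (-(u ^ (3 - 2 * ε) + u ^ (1 - 2 * ε)) *
          u ^ (4 * (1 - (3 / 4 - ε / 2)))) * e1
    _ ≤ _ := by gcongr

lemma exists_lintegral_latticeKernel_le {ε : ℝ} (hε : 0 < ε) (hε2 : ε ≤ 1 / 2) :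
    ∃ C : ℝ≥0∞, C ≠ ⊤ ∧ ∀ δ : ℝ, 0 ≤ δ → ∀ t : ℝ, 0 < t → ∀ x : Fin 4 → ℤ,
      ∫⁻ u in Set.Ioi (0 : ℝ), ENNReal.ofReal ((u ^ 4 + u ^ 2) / (t ^ 2 + u ^ 4) *
        ‖latticeKernel δ x (u ^ 2)‖) ≤ C * ENNReal.ofReal (t ^ (-(3 / 2) + ε)) := by
  obtain ⟨C, hC, h⟩ := exists_lintegral_besselKernel_le hε hε2
  refine ⟨4 * C, ENNReal.mul_ne_top (by simp) hC, fun δ hδ t ht x => ?_⟩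
  have hm : ∀ n : ℤ, Measurable fun u : ℝ =>
      ENNReal.ofReal ((u ^ (3 - 2 * ε) + u ^ (1 - 2 * ε)) * ‖besselKernel δ n (u ^ 2)‖ ^ 4) := by
    intro n
    have := (measurable_besselKernel δ n).comp (measurable_id.pow_const 2)
    exact ENNReal.measurable_ofReal.comp
      (Measurable.mul (by fun_prop) (this.norm.pow_const 4))
  calc ∫⁻ u in Set.Ioi (0 : ℝ), ENNReal.ofReal ((u ^ 4 + u ^ 2) / (t ^ 2 + u ^ 4) *
        ‖latticeKernel δ x (u ^ 2)‖)
      ≤ ∫⁻ u in Set.Ioi (0 : ℝ), ENNReal.ofReal (t ^ (-(3 / 2) + ε)) * ∑ j : Fin 4,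
          ENNReal.ofReal ((u ^ (3 - 2 * ε) + u ^ (1 - 2 * ε)) *
            ‖besselKernel δ (x j) (u ^ 2)‖ ^ 4) := by
        refine setLIntegral_mono' measurableSet_Ioi fun u hu => ?_
        have hu : 0 < u := hu
        rw [← ENNReal.ofReal_sum_of_nonneg fun j _ => by positivity,
          ← ENNReal.ofReal_mul (by positivity), ← Finset.mul_sum, ← mul_assoc]
        exact ENNReal.ofReal_le_ofReal (mul_le_mul (weight_le hε hε2 ht hu)
          (norm_latticeKernel_le δ x _) (norm_nonneg _) (by positivity))
    _ = ENNReal.ofReal (t ^ (-(3 / 2) + ε)) * ∑ j : Fin 4, ∫⁻ u in Set.Ioi (0 : ℝ),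
          ENNReal.ofReal ((u ^ (3 - 2 * ε) + u ^ (1 - 2 * ε)) *
            ‖besselKernel δ (x j) (u ^ 2)‖ ^ 4) := by
        rw [lintegral_const_mul _ (Finset.measurable_sum _ fun j _ => hm (x j)),
          lintegral_finsetSum _ fun j _ => hm (x j)]
    _ ≤ ENNReal.ofReal (t ^ (-(3 / 2) + ε)) * ∑ j : Fin 4, C := by
        gcongr with j
        exact h δ hδ (x j)
    _ = _ := by
        rw [Finset.sum_const, Finset.card_univ, Fintype.card_fin, nsmul_eq_mul, mul_comm]
        norm_cast

lemma latticeSymbol_le (ξ : Fin 4 → ℝ) : latticeSymbol 4 ξ ≤ 16 := by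
  have h : latticeSymbol 4 ξ ≤ ∑ _j : Fin 4, (4 : ℝ) :=
    Finset.sum_le_sum fun j _ => by linarith [Real.neg_one_le_cos (ξ j)]
  simp at h
  linarith

lemma integrable_prod_gaussian {r : ℝ} (hr : r < 0) :
    Integrable (fun p : (Fin 4 → ℝ) × ℝ => Real.exp (r * (latticeSymbol 4 p.1 * p.2 ^ 2)))
      ((volume.restrict (torusBox 4)).prod (volume.restrict (Set.Ioi 0))) := by
  have hc := continuous_latticeSymbol 4
  rw [integrable_prod_iff (Continuous.aestronglyMeasurable (by fun_prop))]
  refine ⟨?_, ?_⟩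
  · filter_upwards [ae_latticeSymbol_pos 4] with ξ hξ
    exact (integrable_exp_re_mul hξ hr).integrableOn
  · refine (integrable_one_div_discOmega.const_mul (√(Real.pi / -r) / 2)).congr ?_
    filter_upwards [ae_latticeSymbol_pos 4] with ξ hξ
    have h := integral_gaussian_Ioi (-r * latticeSymbol 4 ξ)
    simp_rw [Real.norm_eq_abs, Real.abs_exp]
    have e : ∀ u : ℝ, r * (latticeSymbol 4 ξ * u ^ 2) = -(-r * latticeSymbol 4 ξ) * u ^ 2 :=
      fun u => by ring
    simp_rw [e, h]
    rw [← div_div, Real.sqrt_div (div_nonneg Real.pi_pos.le (by linarith)), discOmega_eq]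
    ring

/-- The integrand obtained by inserting the subordination formula into the Fourier integral. -/
noncomputable def subordIntegrand (z : ℂ) (t : ℝ) (x : Fin 4 → ℤ) (ξ : Fin 4 → ℝ) (u : ℝ) : ℂ :=
  latticeChar x ξ *
    (((((1 + 4 * latticeSymbol 4 ξ) * subordWeight t u : ℝ) : ℂ) +
      2 / z * (subordCorrection t u : ℝ)) * cexp (z * (subordPhase t (latticeSymbol 4 ξ) u : ℝ)))

lemma integrable_subordIntegrand {z : ℂ} (hz : z.re < 0) {t : ℝ} (ht : 0 < t) (x : Fin 4 → ℤ) :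
    Integrable (Function.uncurry (subordIntegrand z t x))
      ((volume.restrict (torusBox 4)).prod (volume.restrict (Set.Ioi 0))) := by
  have hs := (continuous_latticeSymbol 4).measurable
  have hch := (continuous_latticeChar x).measurable
  refine ((integrable_prod_gaussian hz).const_mul
    ((1 + 4 * 16) + 2 / ‖z‖ * (3 * (1 / t)))).mono' ?_ (.of_forall fun p => ?_)
  · refine Measurable.aestronglyMeasurable ?_
    unfold subordIntegrand subordWeight subordCorrection subordPhase Function.uncurry
    have hsp : Measurable fun p : (Fin 4 → ℝ) × ℝ => latticeSymbol 4 p.1 := hs.comp measurable_fst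
    refine (hch.comp measurable_fst).mul (Measurable.mul (Measurable.add ?_ ?_) ?_)
    · exact Complex.measurable_ofReal.comp (((hsp.const_mul 4).const_add 1).mul (by fun_prop))
    · exact (Complex.measurable_ofReal.comp (by fun_prop)).const_mul _
    · exact ((Complex.measurable_ofReal.comp
        ((hsp.mul (by fun_prop)).add (by fun_prop))).const_mul z).cexp
  · have hnn := latticeSymbol_nonneg 4 p.1
    rw [Function.uncurry, subordIntegrand, norm_mul, norm_latticeChar, one_mul, norm_mul]
    refine mul_le_mul ((norm_subord_weight_le ht hnn p.2).trans ?_)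
      (norm_cexp_mul_subordPhase_le hz p.2) (norm_nonneg _) (by positivity)
    linarith [latticeSymbol_le p.1]

lemma integral_subordIntegrand_left {z : ℂ} (hz : z.re < 0) {t : ℝ} (ht : 0 < t) (x : Fin 4 → ℤ) :
    ∫ ξ in torusBox 4, ∫ u in Set.Ioi (0 : ℝ), subordIntegrand z t x ξ u =
      (Real.pi / -z) ^ (1 / 2 : ℂ) / 2 * ∫ ξ in torusBox 4,
        latticeChar x ξ * (cexp (z * (t * discOmega 4 ξ : ℝ)) * (1 / discOmega 4 ξ : ℝ)) := by
  rw [← integral_const_mul]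
  refine integral_congr_ae ?_
  filter_upwards [ae_latticeSymbol_pos 4] with ξ hξ
  unfold subordIntegrand
  rw [integral_const_mul, integral_subord ht hξ hz, discOmega_eq]
  push_cast
  field_simp

lemma integral_subordIntegrand_right (δ t : ℝ) (x : Fin 4 → ℤ) (u : ℝ) :
    ∫ ξ in torusBox 4, subordIntegrand (I - δ) t x ξ u =
      cexp ((I - δ) * (t ^ 2 / (4 * u ^ 2) : ℝ)) *
        ((subordWeight t u : ℝ) * (33 * latticeKernel δ x (u ^ 2) - 4 * ∑ j,
          (latticeKernel δ (x + Pi.single j 1) (u ^ 2) +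
            latticeKernel δ (x - Pi.single j 1) (u ^ 2))) +
          2 / (I - δ) * (subordCorrection t u : ℝ) * latticeKernel δ x (u ^ 2)) := by
  have hc := continuous_latticeSymbol 4
  have h2 := continuous_latticeChar x
  have h : ∀ ξ, subordIntegrand (I - δ) t x ξ u = cexp ((I - δ) * (t ^ 2 / (4 * u ^ 2) : ℝ)) *
      ((subordWeight t u : ℝ) * (((1 + 4 * latticeSymbol 4 ξ : ℝ) : ℂ) *
        (latticeChar x ξ * cexp ((I - δ) * (u ^ 2 : ℝ) * (latticeSymbol 4 ξ : ℝ)))) +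
        2 / (I - δ) * (subordCorrection t u : ℝ) *
        (latticeChar x ξ * cexp ((I - δ) * (u ^ 2 : ℝ) * (latticeSymbol 4 ξ : ℝ)))) := by
    intro ξ
    have he : cexp ((I - δ) * (subordPhase t (latticeSymbol 4 ξ) u : ℝ)) =
        cexp ((I - δ) * (t ^ 2 / (4 * u ^ 2) : ℝ)) *
          cexp ((I - δ) * (u ^ 2 : ℝ) * (latticeSymbol 4 ξ : ℝ)) := by
      rw [← Complex.exp_add, subordPhase]
      push_cast
      ring_nf
    rw [subordIntegrand, he, Complex.ofReal_mul]
    ring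
  have hi1 : IntegrableOn (fun ξ => ((1 + 4 * latticeSymbol 4 ξ : ℝ) : ℂ) *
      (latticeChar x ξ * cexp ((I - δ) * (u ^ 2 : ℝ) * (latticeSymbol 4 ξ : ℝ)))) (torusBox 4) :=
    (Continuous.continuousOn (by fun_prop)).integrableOn_compact (isCompact_torusBox 4)
  simp_rw [h]
  rw [integral_const_mul, integral_add (hi1.const_mul _)
    ((integrable_latticeChar_mul_exp δ x (u ^ 2)).const_mul _), integral_const_mul,
    integral_const_mul, integral_symbol_mul_latticeChar_mul_exp, integral_latticeChar_mul_exp]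

/-- The nine lattice kernels that control the Fourier integral at `x`. -/
noncomputable def neighborKernel (δ : ℝ) (x : Fin 4 → ℤ) (σ : ℝ) : ℝ :=
  ‖latticeKernel δ x σ‖ + ∑ j, (‖latticeKernel δ (x + Pi.single j 1) σ‖ +
    ‖latticeKernel δ (x - Pi.single j 1) σ‖)

lemma norm_integral_subordIntegrand_right_le {δ t : ℝ} (hδ : 0 < δ) (ht : 0 < t) (x : Fin 4 → ℤ)
    (u : ℝ) :
    ‖∫ ξ in torusBox 4, subordIntegrand (I - δ) t x ξ u‖ ≤
      39 * ((u ^ 4 + u ^ 2) / (t ^ 2 + u ^ 4) * neighborKernel δ x (u ^ 2)) := by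
  have hz1 : 1 ≤ ‖I - (δ : ℂ)‖ := by
    have := abs_im_le_norm (I - (δ : ℂ))
    simpa using this
  set K := ‖latticeKernel δ x (u ^ 2)‖
  set S := ∑ j, (‖latticeKernel δ (x + Pi.single j 1) (u ^ 2)‖ +
    ‖latticeKernel δ (x - Pi.single j 1) (u ^ 2)‖) with hS
  have hK0 : 0 ≤ K := norm_nonneg _
  have hS0 : 0 ≤ S := Finset.sum_nonneg fun j _ => by positivity
  have hexp : ‖cexp ((I - δ) * (t ^ 2 / (4 * u ^ 2) : ℝ))‖ ≤ 1 := by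
    rw [norm_exp, Real.exp_le_one_iff, re_mul_ofReal]
    refine mul_nonpos_of_nonpos_of_nonneg ?_ (by positivity)
    simpa using hδ.le
  have h1 : ‖(33 * latticeKernel δ x (u ^ 2) - 4 * ∑ j,
          (latticeKernel δ (x + Pi.single j 1) (u ^ 2) +
            latticeKernel δ (x - Pi.single j 1) (u ^ 2)))‖ ≤ 33 * K + 4 * S := by
    refine (norm_sub_le _ _).trans (add_le_add (by simp [K]) ?_)
    rw [norm_mul, RCLike.norm_ofNat]
    refine mul_le_mul_of_nonneg_left ?_ (by norm_num)
    exact (norm_sum_le _ _).trans (Finset.sum_le_sum fun j _ => norm_add_le _ _)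
  have h2 : ‖2 / (I - (δ : ℂ)) * (subordCorrection t u : ℝ) * latticeKernel δ x (u ^ 2)‖ ≤
      6 * (u ^ 2 / (t ^ 2 + u ^ 4)) * K := by
    rw [norm_mul, norm_mul, norm_div, norm_real, Real.norm_eq_abs, RCLike.norm_ofNat]
    refine mul_le_mul_of_nonneg_right ?_ hK0
    calc 2 / ‖I - (δ : ℂ)‖ * |subordCorrection t u| ≤ 2 * (3 * (u ^ 2 / (t ^ 2 + u ^ 4))) :=
          mul_le_mul (div_le_self (by norm_num) hz1) (abs_subordCorrection_le ht u)
            (abs_nonneg _) (by norm_num)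
      _ = _ := by ring
  rw [integral_subordIntegrand_right, norm_mul]
  refine (mul_le_of_le_one_left (norm_nonneg _) hexp).trans ((norm_add_le _ _).trans
    ((add_le_add ?_ h2).trans (b := u ^ 4 / (t ^ 2 + u ^ 4) * (33 * K + 4 * S) +
      6 * (u ^ 2 / (t ^ 2 + u ^ 4)) * K) ?_))
  · rw [norm_mul, norm_real, Real.norm_eq_abs, abs_of_nonneg (subordWeight_nonneg t u)]
    exact mul_le_mul_of_nonneg_left h1 (subordWeight_nonneg t u)
  · have ha : 0 ≤ u ^ 4 / (t ^ 2 + u ^ 4) := by positivity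
    have hb : 0 ≤ u ^ 2 / (t ^ 2 + u ^ 4) := by positivity
    rw [neighborKernel, add_div, ← hS]
    change _ ≤ 39 * ((u ^ 4 / (t ^ 2 + u ^ 4) + u ^ 2 / (t ^ 2 + u ^ 4)) * (K + S))
    nlinarith [mul_nonneg ha hK0, mul_nonneg ha hS0, mul_nonneg hb hK0, mul_nonneg hb hS0]

lemma exists_lintegral_neighborKernel_le {ε : ℝ} (hε : 0 < ε) (hε2 : ε ≤ 1 / 2) :
    ∃ C : ℝ≥0∞, C ≠ ⊤ ∧ ∀ δ : ℝ, 0 ≤ δ → ∀ t : ℝ, 0 < t → ∀ x : Fin 4 → ℤ,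
      ∫⁻ u in Set.Ioi (0 : ℝ), ENNReal.ofReal (39 * ((u ^ 4 + u ^ 2) / (t ^ 2 + u ^ 4) *
        neighborKernel δ x (u ^ 2))) ≤ C * ENNReal.ofReal (t ^ (-(3 / 2) + ε)) := by
  obtain ⟨C, hC, h⟩ := exists_lintegral_latticeKernel_le hε hε2
  refine ⟨39 * (C + ∑ _j : Fin 4, (C + C)), ?_, fun δ hδ t ht x => ?_⟩
  · exact ENNReal.mul_ne_top (by simp) (ENNReal.add_ne_top.2
      ⟨hC, (ENNReal.sum_lt_top.2 fun _ _ => ENNReal.add_lt_top.2 ⟨hC.lt_top, hC.lt_top⟩).ne⟩)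
  have hm : ∀ y : Fin 4 → ℤ, Measurable fun u : ℝ => ENNReal.ofReal
      ((u ^ 4 + u ^ 2) / (t ^ 2 + u ^ 4) * ‖latticeKernel δ y (u ^ 2)‖) := by
    intro y
    have := (measurable_latticeKernel δ y).comp (measurable_id.pow_const 2)
    exact ENNReal.measurable_ofReal.comp (Measurable.mul (by fun_prop) this.norm)
  have hsplit : ∀ u : ℝ, ENNReal.ofReal (39 * ((u ^ 4 + u ^ 2) / (t ^ 2 + u ^ 4) *
      neighborKernel δ x (u ^ 2))) = 39 * (ENNReal.ofReal ((u ^ 4 + u ^ 2) / (t ^ 2 + u ^ 4) *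
        ‖latticeKernel δ x (u ^ 2)‖) + ∑ j, (ENNReal.ofReal ((u ^ 4 + u ^ 2) / (t ^ 2 + u ^ 4) *
        ‖latticeKernel δ (x + Pi.single j 1) (u ^ 2)‖) + ENNReal.ofReal
        ((u ^ 4 + u ^ 2) / (t ^ 2 + u ^ 4) * ‖latticeKernel δ (x - Pi.single j 1) (u ^ 2)‖))) := by
    intro u
    have hw : 0 ≤ (u ^ 4 + u ^ 2) / (t ^ 2 + u ^ 4) := by positivity
    simp_rw [ENNReal.ofReal_mul hw, ← mul_add, ← Finset.mul_sum]
    rw [← mul_add, neighborKernel, ENNReal.ofReal_mul (by norm_num), ENNReal.ofReal_mul hw,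
      ENNReal.ofReal_add (norm_nonneg _) (Finset.sum_nonneg fun j _ => by positivity),
      ENNReal.ofReal_sum_of_nonneg fun j _ => by positivity, ENNReal.ofReal_ofNat]
    simp_rw [ENNReal.ofReal_add (norm_nonneg _) (norm_nonneg _)]
  have hx := fun y => h δ hδ t ht y
  simp_rw [hsplit]
  generalize hg : (fun (y : Fin 4 → ℤ) (u : ℝ) => ENNReal.ofReal
    ((u ^ 4 + u ^ 2) / (t ^ 2 + u ^ 4) * ‖latticeKernel δ y (u ^ 2)‖)) = g
  have hg' : ∀ y u, ENNReal.ofReal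
    ((u ^ 4 + u ^ 2) / (t ^ 2 + u ^ 4) * ‖latticeKernel δ y (u ^ 2)‖) = g y u :=
    fun y u => congrFun (congrFun hg y) u
  simp_rw [hg'] at hm hx ⊢
  have hm2 : ∀ j ∈ Finset.univ, Measurable fun u : ℝ =>
      g (x + Pi.single j 1) u + g (x - Pi.single j 1) u := fun j _ => (hm _).add (hm _)
  rw [lintegral_const_mul' _ _ (by simp), lintegral_add_left (hm x), lintegral_finsetSum _ hm2,
    mul_assoc, add_mul, Finset.sum_mul]
  simp_rw [lintegral_add_left (hm _), add_mul]
  gcongr <;> exact hx _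

lemma one_le_norm_cpow_half {δ : ℝ} (hδ : 0 < δ) (hδ1 : δ ≤ 1) :
    1 ≤ ‖((Real.pi : ℂ) / -(I - δ)) ^ (1 / 2 : ℂ)‖ := by
  have hz1 : 1 ≤ ‖I - (δ : ℂ)‖ := by
    have := abs_im_le_norm (I - (δ : ℂ))
    simpa using this
  have hz2 : ‖I - (δ : ℂ)‖ ≤ 2 := by
    refine (norm_sub_le _ _).trans ?_
    rw [norm_I, norm_real, Real.norm_eq_abs, abs_of_pos hδ]
    linarith
  have e : (1 / 2 : ℂ) = ((1 / 2 : ℝ) : ℂ) := by norm_num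
  rw [e, norm_cpow_real, norm_div, norm_neg, norm_real, Real.norm_eq_abs,
    abs_of_pos Real.pi_pos]
  refine Real.one_le_rpow ?_ (by norm_num)
  rw [le_div_iff₀ (by linarith)]
  linarith [Real.pi_gt_three]

lemma exists_enorm_integral_regularized_le {ε : ℝ} (hε : 0 < ε) (hε2 : ε ≤ 1 / 2) :
    ∃ C : ℝ≥0∞, C ≠ ⊤ ∧ ∀ δ : ℝ, 0 < δ → δ ≤ 1 → ∀ t : ℝ, 0 < t → ∀ x : Fin 4 → ℤ,
      ‖∫ ξ in torusBox 4, latticeChar x ξ *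
        (cexp ((I - δ) * (t * discOmega 4 ξ : ℝ)) * (1 / discOmega 4 ξ : ℝ))‖ₑ ≤
      C * ENNReal.ofReal (t ^ (-(3 / 2) + ε)) := by
  obtain ⟨C, hC, h⟩ := exists_lintegral_neighborKernel_le hε hε2
  refine ⟨2 * C, ENNReal.mul_ne_top (by simp) hC, fun δ hδ hδ1 t ht x => ?_⟩
  have hz : (I - (δ : ℂ)).re < 0 := by simpa using hδ
  have hswap := integral_integral_swap (integrable_subordIntegrand hz ht x)
  rw [integral_subordIntegrand_left hz ht x] at hswap
  set J := ∫ ξ in torusBox 4, latticeChar x ξ *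
        (cexp ((I - δ) * (t * discOmega 4 ξ : ℝ)) * (1 / discOmega 4 ξ : ℝ))
  have h1 : ‖J‖ ≤ 2 * ‖((Real.pi : ℂ) / -(I - δ)) ^ (1 / 2 : ℂ) / 2 * J‖ := by
    rw [norm_mul, norm_div, RCLike.norm_ofNat]
    nlinarith [one_le_norm_cpow_half hδ hδ1, norm_nonneg J]
  have h2 : ‖J‖ₑ ≤ 2 * ‖((Real.pi : ℂ) / -(I - δ)) ^ (1 / 2 : ℂ) / 2 * J‖ₑ := by
    rw [← ofReal_norm, ← ofReal_norm, ← ENNReal.ofReal_ofNat, ← ENNReal.ofReal_mul (by norm_num)]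
    exact ENNReal.ofReal_le_ofReal h1
  rw [hswap] at h2
  refine h2.trans ?_
  rw [mul_assoc]
  refine mul_le_mul_right ?_ 2
  refine (enorm_integral_le_lintegral_enorm _).trans (le_trans ?_ (h δ hδ.le t ht x))
  refine lintegral_mono fun u => ?_
  rw [← ofReal_norm]
  exact ENNReal.ofReal_le_ofReal (norm_integral_subordIntegrand_right_le hδ ht x u)

lemma norm_exp_mul_one_div_discOmega_le {δ t : ℝ} (hδ : 0 ≤ δ) (ht : 0 ≤ t) (x : Fin 4 → ℤ)
    (ξ : Fin 4 → ℝ) :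
    ‖latticeChar x ξ * (cexp ((I - δ) * (t * discOmega 4 ξ : ℝ)) * (1 / discOmega 4 ξ : ℝ))‖ ≤
      1 / discOmega 4 ξ := by
  have h0 : 0 ≤ discOmega 4 ξ := Real.sqrt_nonneg _
  rw [norm_mul, norm_latticeChar, one_mul, norm_mul, norm_real, Real.norm_eq_abs,
    abs_of_nonneg (div_nonneg zero_le_one h0)]
  refine mul_le_of_le_one_left (div_nonneg zero_le_one h0) ?_
  rw [norm_exp, Real.exp_le_one_iff, re_mul_ofReal]
  refine mul_nonpos_of_nonpos_of_nonneg ?_ (mul_nonneg ht h0)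
  simpa using hδ

lemma aestronglyMeasurable_regularized (δ t : ℝ) (x : Fin 4 → ℤ) :
    AEStronglyMeasurable (fun ξ => latticeChar x ξ *
      (cexp ((I - δ) * (t * discOmega 4 ξ : ℝ)) * (1 / discOmega 4 ξ : ℝ)))
      (volume.restrict (torusBox 4)) := by
  have h1 := measurable_discOmega 4
  have h2 := (continuous_latticeChar x).measurable
  exact (h2.mul (((Complex.measurable_ofReal.comp (h1.const_mul t)).const_mul _).cexp.mul
    (Complex.measurable_ofReal.comp (measurable_const.div h1)))).aestronglyMeasurable

lemma exists_enorm_integral_le {ε : ℝ} (hε : 0 < ε) (hε2 : ε ≤ 1 / 2) :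
    ∃ C : ℝ≥0∞, C ≠ ⊤ ∧ ∀ t : ℝ, 0 < t → ∀ x : Fin 4 → ℤ,
      ‖∫ ξ in torusBox 4, latticeChar x ξ *
        (cexp (I * (t * discOmega 4 ξ : ℝ)) * (1 / discOmega 4 ξ : ℝ))‖ₑ ≤
      C * ENNReal.ofReal (t ^ (-(3 / 2) + ε)) := by
  obtain ⟨C, hC, h⟩ := exists_enorm_integral_regularized_le hε hε2
  refine ⟨C, hC, fun t ht x => ?_⟩
  have hlim : Filter.Tendsto (fun δ : ℝ => ∫ ξ in torusBox 4, latticeChar x ξ *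
        (cexp ((I - δ) * (t * discOmega 4 ξ : ℝ)) * (1 / discOmega 4 ξ : ℝ)))
      (nhdsWithin 0 (Set.Ioi 0)) (nhds (∫ ξ in torusBox 4, latticeChar x ξ *
        (cexp (I * (t * discOmega 4 ξ : ℝ)) * (1 / discOmega 4 ξ : ℝ)))) := by
    refine tendsto_integral_filter_of_dominated_convergence (fun ξ => 1 / discOmega 4 ξ)
      (.of_forall fun δ => aestronglyMeasurable_regularized δ t x)
      (eventually_nhdsWithin_of_forall fun δ hδ => .of_forall fun ξ =>
        norm_exp_mul_one_div_discOmega_le (le_of_lt hδ) ht.le x ξ)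
      integrable_one_div_discOmega (.of_forall fun ξ => ?_)
    have hc : Continuous fun δ : ℝ => latticeChar x ξ *
        (cexp ((I - δ) * (t * discOmega 4 ξ : ℝ)) * (1 / discOmega 4 ξ : ℝ)) := by fun_prop
    have := hc.tendsto 0
    rw [Complex.ofReal_zero, sub_zero] at this
    exact this.mono_left nhdsWithin_le_nhds
  refine le_of_tendsto hlim.enorm ?_
  have h1 : ∀ᶠ δ : ℝ in nhdsWithin 0 (Set.Ioi 0), δ ∈ Set.Ioc (0 : ℝ) 1 :=
    Ioc_mem_nhdsGT zero_lt_one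
  filter_upwards [h1] with δ hδ using h δ hδ.1 hδ.2 t ht x

lemma integrable_latticeChar_mul_exp_div_discOmega (t : ℝ) (x : Fin 4 → ℤ) :
    IntegrableOn (fun ξ => latticeChar x ξ *
      (cexp (I * (t * discOmega 4 ξ : ℝ)) * (1 / discOmega 4 ξ : ℝ))) (torusBox 4) := by
  have h := aestronglyMeasurable_regularized 0 t x
  simp only [Complex.ofReal_zero, sub_zero] at h
  refine integrable_one_div_discOmega.mono' h (.of_forall fun ξ => ?_)
  have h0 : 0 ≤ discOmega 4 ξ := Real.sqrt_nonneg _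
  rw [norm_mul, norm_latticeChar, norm_mul, mul_comm I, norm_exp_ofReal_mul_I, norm_real,
    Real.norm_eq_abs, abs_of_nonneg (div_nonneg zero_le_one h0), one_mul, one_mul]

lemma latticeChar_neg {d : ℕ} (x : Fin d → ℤ) (ξ : Fin d → ℝ) :
    latticeChar (-x) ξ = (starRingEnd ℂ) (latticeChar x ξ) := by
  rw [latticeChar, latticeChar, ← Complex.exp_conj, map_mul, conj_I, conj_ofReal]
  congr 1
  simp [Finset.sum_neg_distrib]

lemma greenG_eq (x : Fin 4 → ℤ) (t : ℝ) :
    greenG 4 x t = ((2 * Real.pi : ℂ) ^ 4)⁻¹ * ((2 * I)⁻¹ *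
      ((∫ ξ in torusBox 4, latticeChar x ξ *
        (cexp (I * (t * discOmega 4 ξ : ℝ)) * (1 / discOmega 4 ξ : ℝ))) -
      (starRingEnd ℂ) (∫ ξ in torusBox 4, latticeChar (-x) ξ *
        (cexp (I * (t * discOmega 4 ξ : ℝ)) * (1 / discOmega 4 ξ : ℝ))))) := by
  have h2 : IntegrableOn (fun ξ => (starRingEnd ℂ) (latticeChar (-x) ξ *
        (cexp (I * (t * discOmega 4 ξ : ℝ)) * (1 / discOmega 4 ξ : ℝ)))) (torusBox 4) :=
    ContinuousLinearMap.integrable_comp (conjCLE : ℂ →L[ℝ] ℂ)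
      (integrable_latticeChar_mul_exp_div_discOmega t (-x))
  rw [greenG, ← integral_conj, ← integral_sub (integrable_latticeChar_mul_exp_div_discOmega t x) h2]
  congr 1
  rw [← integral_const_mul]
  refine integral_congr_ae (.of_forall fun ξ => ?_)
  simp only [latticeChar_neg, map_mul, conj_conj, ← Complex.exp_conj, conj_I, conj_ofReal]
  rw [latticeChar, Complex.ofReal_div, ofReal_sin, Complex.sin, Complex.ofReal_div,
    Complex.ofReal_one]
  have hI : (2 * I)⁻¹ = -I / 2 := by
    rw [mul_inv, inv_I]; ring
  rw [hI, mul_comm _ I, mul_comm _ I, mul_neg, neg_mul]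
  ring_nf

lemma norm_greenG_neg (x : Fin 4 → ℤ) (t : ℝ) : ‖greenG 4 x (-t)‖ = ‖greenG 4 x t‖ := by
  have : greenG 4 x (-t) = -greenG 4 x t := by
    simp only [greenG, neg_mul, Real.sin_neg, neg_div, Complex.ofReal_neg, mul_neg, integral_neg]
  rw [this, norm_neg]

lemma exists_norm_greenG_le_of_le_one :
    ∃ C : ℝ, 0 ≤ C ∧ ∀ t : ℝ, |t| ≤ 1 → ∀ x : Fin 4 → ℤ, ‖greenG 4 x t‖ ≤ C := by
  refine ⟨‖((2 * Real.pi : ℂ) ^ 4)⁻¹‖ * (1 * (volume.real (torusBox 4))), by positivity,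
    fun t ht x => ?_⟩
  rw [greenG, norm_mul]
  refine mul_le_mul_of_nonneg_left ?_ (norm_nonneg _)
  refine norm_setIntegral_le_of_norm_le_const (isCompact_torusBox 4).measure_lt_top fun ξ _ => ?_
  change ‖latticeChar x ξ * _‖ ≤ 1
  rw [norm_mul, norm_latticeChar, one_mul, norm_real, Real.norm_eq_abs, abs_div]
  refine div_le_one_of_le₀ ?_ (abs_nonneg _)
  refine (Real.abs_sin_le_abs (x := t * discOmega 4 ξ)).trans ?_
  rw [abs_mul]
  exact mul_le_of_le_one_left (abs_nonneg _) ht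

/-- The dispersive estimate for the Green's function in dimension four. -/
lemma exists_norm_greenG_le {ε : ℝ} (hε : 0 < ε) (hε2 : ε ≤ 1 / 2) :
    ∃ C : ℝ, 0 < C ∧ ∀ (t : ℝ) (x : Fin 4 → ℤ),
      ‖greenG 4 x t‖ ≤ C * (1 + |t|) ^ (-(3 / 2) + ε) := by
  obtain ⟨C, hC, h⟩ := exists_enorm_integral_le hε hε2
  obtain ⟨D, hD, hD'⟩ := exists_norm_greenG_le_of_le_one
  have h' : ∀ t : ℝ, 0 < t → ∀ x : Fin 4 → ℤ, ‖∫ ξ in torusBox 4, latticeChar x ξ *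
        (cexp (I * (t * discOmega 4 ξ : ℝ)) * (1 / discOmega 4 ξ : ℝ))‖ ≤
      C.toReal * t ^ (-(3 / 2) + ε) := by
    intro t ht x
    have := ENNReal.toReal_mono (ENNReal.mul_ne_top hC ENNReal.ofReal_ne_top) (h t ht x)
    rwa [toReal_enorm, ENNReal.toReal_mul, ENNReal.toReal_ofReal (by positivity)] at this
  have hpos : ∀ t : ℝ, 0 < t → ∀ x : Fin 4 → ℤ,
      ‖greenG 4 x t‖ ≤ C.toReal * t ^ (-(3 / 2) + ε) := by
    intro t ht x
    have h1 : ‖((2 * Real.pi : ℂ) ^ 4)⁻¹‖ ≤ 1 := by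
      rw [norm_inv, norm_pow, norm_mul, norm_real, Real.norm_eq_abs, abs_of_pos Real.pi_pos,
        RCLike.norm_ofNat]
      exact inv_le_one_of_one_le₀ (one_le_pow₀ (by linarith [Real.pi_gt_three]))
    have h2 : ‖(2 * I)⁻¹‖ = 1 / 2 := by simp
    rw [greenG_eq, norm_mul]
    refine (mul_le_of_le_one_left (norm_nonneg _) h1).trans ?_
    rw [norm_mul, h2]
    have h3 := norm_sub_le (∫ ξ in torusBox 4, latticeChar x ξ *
        (cexp (I * (t * discOmega 4 ξ : ℝ)) * (1 / discOmega 4 ξ : ℝ)))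
      ((starRingEnd ℂ) (∫ ξ in torusBox 4, latticeChar (-x) ξ *
        (cexp (I * (t * discOmega 4 ξ : ℝ)) * (1 / discOmega 4 ξ : ℝ))))
    rw [RCLike.norm_conj] at h3
    linarith [h' t ht x, h' t ht (-x)]
  have habs : ∀ t : ℝ, 0 < |t| → ∀ x : Fin 4 → ℤ,
      ‖greenG 4 x t‖ ≤ C.toReal * |t| ^ (-(3 / 2) + ε) := by
    intro t ht x
    rcases abs_choice t with e | e
    · rw [e] at ht ⊢; exact hpos t ht x
    · rw [e] at ht ⊢; rw [← norm_greenG_neg]; exact hpos (-t) ht x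
  have h2r : (0 : ℝ) < 2 ^ (3 / 2 - ε) := by positivity
  refine ⟨2 ^ (3 / 2 - ε) * (C.toReal + D + 1), by positivity, fun t x => ?_⟩
  have ha : 0 < 1 + |t| := by positivity
  have key : ((1 + |t|) / 2) ^ (-(3 / 2) + ε) =
      2 ^ (3 / 2 - ε) * (1 + |t|) ^ (-(3 / 2) + ε) := by
    rw [Real.div_rpow ha.le zero_le_two, div_eq_mul_inv, ← Real.rpow_neg zero_le_two, mul_comm]
    ring_nf
  have hk0 : 0 < ((1 + |t|) / 2) ^ (-(3 / 2) + ε) := by positivity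
  rw [mul_right_comm, ← key]
  rcases le_total |t| 1 with ht | ht
  · have h1 : 1 ≤ ((1 + |t|) / 2) ^ (-(3 / 2) + ε) :=
      Real.one_le_rpow_of_pos_of_le_one_of_nonpos (by positivity) (by linarith) (by linarith)
    have := hD' t ht x
    nlinarith [ENNReal.toReal_nonneg (a := C)]
  · have h1 : |t| ^ (-(3 / 2) + ε) ≤ ((1 + |t|) / 2) ^ (-(3 / 2) + ε) :=
      Real.rpow_le_rpow_of_nonpos (by positivity) (by linarith) (by linarith)
    have := habs t (by linarith) x
    nlinarith [ENNReal.toReal_nonneg (a := C)]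

lemma integral_latticeChar {d : ℕ} {x : Fin d → ℤ} (hx : x ≠ 0) :
    ∫ ξ in torusBox d, latticeChar x ξ = 0 := by
  have h : ∀ ξ : Fin d → ℝ, latticeChar x ξ = ∏ j, cexp (I * (x j * ξ j)) := fun ξ => by
    rw [latticeChar, ← Complex.exp_sum, ← Finset.mul_sum]
    push_cast
    rfl
  simp_rw [h]
  rw [restrict_torusBox, integral_fintype_prod_eq_prod (f := fun j (s : ℝ) => cexp (I * (x j * s)))]
  obtain ⟨i, hi⟩ := Function.ne_iff.mp hx
  refine Finset.prod_eq_zero (Finset.mem_univ i) ?_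
  have hc : I * (x i : ℂ) ≠ 0 := mul_ne_zero I_ne_zero (by exact_mod_cast hi)
  rw [integral_Icc_eq_integral_Ioc, ← intervalIntegral.integral_of_le (by linarith [Real.pi_pos])]
  simp_rw [← mul_assoc]
  rw [integral_exp_mul_complex hc]
  refine div_eq_zero_iff.2 (Or.inl (sub_eq_zero.2 (Complex.exp_eq_exp_iff_exists_int.2 ?_)))
  exact ⟨x i, by push_cast; ring⟩

lemma memLp_conj_latticeChar {d : ℕ} (x : Fin d → ℤ) :
    MemLp (fun ξ => (starRingEnd ℂ) (latticeChar x ξ)) 2 (volume.restrict (torusBox d)) :=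
  .of_bound (continuous_conj.comp (continuous_latticeChar x)).aestronglyMeasurable 1
    (.of_forall fun ξ => by rw [RCLike.norm_conj, norm_latticeChar])

lemma inner_toLp_conj_latticeChar {d : ℕ} (x : Fin d → ℤ) {g : (Fin d → ℝ) → ℂ}
    (hg : MemLp g 2 (volume.restrict (torusBox d))) :
    inner ℂ (memLp_conj_latticeChar x).toLp hg.toLp = ∫ ξ in torusBox d, latticeChar x ξ * g ξ := by
  rw [L2.inner_def]
  refine integral_congr_ae ?_
  filter_upwards [(memLp_conj_latticeChar x).coeFn_toLp, hg.coeFn_toLp] with ξ h1 h2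
  rw [h1, h2, RCLike.inner_apply, conj_conj, mul_comm]

lemma volume_real_torusBox (d : ℕ) : volume.real (torusBox d) = (2 * Real.pi) ^ d := by
  rw [torusBox, measureReal_def, volume_pi_pi, Finset.prod_const, Finset.card_univ,
    Fintype.card_fin, Real.volume_Icc, ENNReal.toReal_pow,
    ENNReal.toReal_ofReal (by linarith [Real.pi_pos])]
  ring

lemma orthonormal_latticeChar (d : ℕ) :
    Orthonormal ℂ fun x : Fin d → ℤ =>
      (((√((2 * Real.pi) ^ d))⁻¹ : ℝ) : ℂ) • (memLp_conj_latticeChar x).toLp := by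
  rw [orthonormal_iff_ite]
  intro x y
  have hpos : (0 : ℝ) < (2 * Real.pi) ^ d := by positivity
  have hmul : ∀ ξ : Fin d → ℝ, latticeChar x ξ * (starRingEnd ℂ) (latticeChar y ξ) =
      latticeChar (x - y) ξ := fun ξ => by
    rw [← latticeChar_neg, latticeChar, latticeChar, latticeChar, ← Complex.exp_add, ← mul_add,
      ← Complex.ofReal_add, ← Finset.sum_add_distrib]
    congr 3
    refine Finset.sum_congr rfl fun j _ => ?_
    simp only [Pi.neg_apply, Pi.sub_apply]
    push_cast
    ring
  rw [inner_smul_left, inner_smul_right, inner_toLp_conj_latticeChar, conj_ofReal]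
  simp_rw [hmul]
  split_ifs with h
  · have h0 : ∀ ξ : Fin d → ℝ, latticeChar (x - y) ξ = 1 := fun ξ => by
      simp [latticeChar, h]
    simp_rw [h0]
    rw [setIntegral_const, volume_real_torusBox, Complex.real_smul, mul_one, ← Complex.ofReal_mul,
      ← Complex.ofReal_mul, ← mul_assoc, ← mul_inv, Real.mul_self_sqrt hpos.le,
      inv_mul_cancel₀ hpos.ne', Complex.ofReal_one]
  · rw [integral_latticeChar (sub_ne_zero.2 h), mul_zero, mul_zero]

lemma norm_toLp_sq {α : Type*} [MeasurableSpace α] {μ : Measure α} {g : α → ℂ} (hg : MemLp g 2 μ) :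
    ‖hg.toLp‖ ^ 2 = ∫ a, ‖g a‖ ^ 2 ∂μ := by
  have h := inner_self_eq_norm_sq_to_K (𝕜 := ℂ) hg.toLp
  rw [L2.inner_def] at h
  have h2 : ∫ a, inner ℂ (hg.toLp g a) (hg.toLp g a) ∂μ = ((∫ a, ‖g a‖ ^ 2 ∂μ : ℝ) : ℂ) := by
    refine Eq.trans ?_ (integral_ofReal (𝕜 := ℂ))
    refine integral_congr_ae ?_
    filter_upwards [hg.coeFn_toLp] with a ha
    rw [ha, inner_self_eq_norm_sq_to_K]
    exact (Complex.ofReal_pow _ _).symm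
  rw [h2] at h
  refine Complex.ofReal_injective (h.trans ?_).symm
  exact (Complex.ofReal_pow _ _).symm

/-- Bessel's inequality for the Fourier coefficients of `g` on the cube `[-π, π]^d`. -/
lemma sum_norm_integral_latticeChar_sq_le {d : ℕ} {g : (Fin d → ℝ) → ℂ}
    (hg : MemLp g 2 (volume.restrict (torusBox d))) (s : Finset (Fin d → ℤ)) :
    ∑ x ∈ s, ‖∫ ξ in torusBox d, latticeChar x ξ * g ξ‖ ^ 2 ≤
      (2 * Real.pi) ^ d * ‖hg.toLp‖ ^ 2 := by
  have hpos : (0 : ℝ) < (2 * Real.pi) ^ d := by positivity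
  have h := (orthonormal_latticeChar d).sum_inner_products_le hg.toLp (s := s)
  have hn : ∀ x : Fin d → ℤ,
      ‖inner ℂ ((((√((2 * Real.pi) ^ d))⁻¹ : ℝ) : ℂ) • (memLp_conj_latticeChar x).toLp) hg.toLp‖ ^ 2
        = ((2 * Real.pi) ^ d)⁻¹ * ‖∫ ξ in torusBox d, latticeChar x ξ * g ξ‖ ^ 2 := fun x => by
    rw [inner_smul_left, inner_toLp_conj_latticeChar, norm_mul, conj_ofReal, norm_real,
      Real.norm_eq_abs, mul_pow, sq_abs, inv_pow, Real.sq_sqrt hpos.le]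
  rwa [Finset.sum_congr rfl fun x _ => hn x, ← Finset.mul_sum, inv_mul_le_iff₀ hpos] at h

lemma norm_sin_div_discOmega_sq_le (t : ℝ) (ξ : Fin 4 → ℝ) :
    ‖((Real.sin (t * discOmega 4 ξ) / discOmega 4 ξ : ℝ) : ℂ)‖ ^ 2 ≤ 1 / latticeSymbol 4 ξ := by
  rw [norm_real, Real.norm_eq_abs, sq_abs, div_pow, discOmega_sq]
  exact div_le_div_of_nonneg_right (Real.sin_sq_le_one _) (latticeSymbol_nonneg 4 ξ)

lemma memLp_sin_div_discOmega (t : ℝ) :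
    MemLp (fun ξ => ((Real.sin (t * discOmega 4 ξ) / discOmega 4 ξ : ℝ) : ℂ)) 2
      (volume.restrict (torusBox 4)) := by
  have hm : Measurable fun ξ => ((Real.sin (t * discOmega 4 ξ) / discOmega 4 ξ : ℝ) : ℂ) := by
    have := measurable_discOmega 4
    fun_prop
  rw [memLp_two_iff_integrable_sq_norm hm.aestronglyMeasurable]
  refine integrable_one_div_latticeSymbol.mono' (hm.norm.pow_const 2).aestronglyMeasurable
    (.of_forall fun ξ => ?_)
  rw [Real.norm_of_nonneg (sq_nonneg _)]
  exact norm_sin_div_discOmega_sq_le t ξ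

/-- The Green's function is square summable, uniformly in time. -/
lemma exists_tsum_enorm_greenG_sq_le :
    ∃ C : ℝ, 0 ≤ C ∧ ∀ t : ℝ, ∑' x : Fin 4 → ℤ, ‖greenG 4 x t‖ₑ ^ 2 ≤ ENNReal.ofReal C := by
  set c := ‖((2 * Real.pi : ℂ) ^ 4)⁻¹‖ ^ 2
  set K := (2 * Real.pi) ^ 4 * ∫ ξ in torusBox 4, 1 / latticeSymbol 4 ξ
  have hK : 0 ≤ K := mul_nonneg (by positivity)
    (integral_nonneg fun ξ => div_nonneg zero_le_one (latticeSymbol_nonneg 4 ξ))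
  refine ⟨c * K, mul_nonneg (sq_nonneg _) hK, fun t => ?_⟩
  rw [ENNReal.tsum_eq_iSup_sum]
  refine iSup_le fun s => ?_
  have hg := memLp_sin_div_discOmega t
  have hnorm : ‖hg.toLp‖ ^ 2 ≤ ∫ ξ in torusBox 4, 1 / latticeSymbol 4 ξ := by
    rw [norm_toLp_sq]
    refine integral_mono ((memLp_two_iff_integrable_sq_norm hg.1).1 hg)
      integrable_one_div_latticeSymbol fun ξ => norm_sin_div_discOmega_sq_le t ξ
  have h : ∑ x ∈ s, ‖greenG 4 x t‖ ^ 2 ≤ c * K := by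
    have hx : ∀ x : Fin 4 → ℤ, ‖greenG 4 x t‖ ^ 2 = c * ‖∫ ξ in torusBox 4,
        latticeChar x ξ * ((Real.sin (t * discOmega 4 ξ) / discOmega 4 ξ : ℝ) : ℂ)‖ ^ 2 :=
      fun x => by rw [← mul_pow, ← norm_mul]; rfl
    rw [Finset.sum_congr rfl fun x _ => hx x, ← Finset.mul_sum]
    exact mul_le_mul_of_nonneg_left ((sum_norm_integral_latticeChar_sq_le hg s).trans
      (mul_le_mul_of_nonneg_left hnorm (by positivity))) (sq_nonneg _)
  refine le_trans (le_of_eq ?_) (ENNReal.ofReal_le_ofReal h)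
  rw [ENNReal.ofReal_sum_of_nonneg fun x _ => sq_nonneg _]
  refine Finset.sum_congr rfl fun x _ => ?_
  rw [ENNReal.ofReal_pow (norm_nonneg _), ofReal_norm]

lemma rpow_mul_rpow_sub (a : ℝ≥0∞) {r θ : ℝ} (hr : 0 < r) (hθ : 0 ≤ θ) (hθr : θ ≤ 1 / r) :
    (a ^ r) ^ θ * (a ^ r) ^ (1 / r - θ) = a := by
  rw [← ENNReal.rpow_add_of_nonneg _ _ hθ (sub_nonneg.2 hθr), add_sub_cancel, ← ENNReal.rpow_mul,
    mul_one_div_cancel hr.ne', ENNReal.rpow_one]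

lemma tsum_mul_le_rpow_mul {ι : Type*} [AddCommGroup ι] (a b : ι → ℝ≥0∞) {p r θ : ℝ} (hp : 0 < p)
    (hr : 0 < r) (hθ : 0 ≤ θ) (hθr : θ ≤ 1 / r) (hθp : θ ≤ 1 / p) (h : 1 / r + 1 / p = 1 + θ)
    (x : ι) :
    ∑' y, a (x - y) * b y ≤ (∑' y, a (x - y) ^ r * b y ^ p) ^ θ *
      ((∑' y, a y ^ r) ^ (1 / r - θ) * (∑' y, b y ^ p) ^ (1 / p - θ)) := by
  let _ : MeasurableSpace ι := ⊤
  have h0 : ∀ i : Fin 3, 0 ≤ (![θ, 1 / r - θ, 1 / p - θ] : Fin 3 → ℝ) i := by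
    simp only [Fin.forall_fin_succ]
    refine ⟨hθ, sub_nonneg.2 hθr, sub_nonneg.2 hθp, fun i => i.elim0⟩
  have hH := ENNReal.lintegral_prod_norm_pow_le (μ := (Measure.count : Measure ι))
    (Finset.univ : Finset (Fin 3))
    (f := ![fun y => a (x - y) ^ r * b y ^ p, fun y => a (x - y) ^ r, fun y => b y ^ p])
    (fun i _ => measurable_from_top.aemeasurable)
    (p := ![θ, 1 / r - θ, 1 / p - θ])
    (by simp only [Fin.sum_univ_three, Matrix.cons_val]; linarith)
    (fun i _ => h0 i)
  simp only [Fin.prod_univ_three, Matrix.cons_val, lintegral_count] at hH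
  have hshift : ∑' y, a (x - y) ^ r = ∑' y, a y ^ r :=
    (Equiv.subLeft x).tsum_eq fun y => a y ^ r
  rw [hshift, mul_assoc (_ ^ θ)] at hH
  refine le_trans (le_of_eq (tsum_congr fun y => ?_)) hH
  rw [ENNReal.mul_rpow_of_nonneg _ _ hθ, mul_right_comm ((a (x - y) ^ r) ^ θ),
    rpow_mul_rpow_sub _ hr hθ hθr, mul_assoc, rpow_mul_rpow_sub _ hp hθ hθp]

/-- Young's convolution inequality on a discrete abelian group. -/
lemma eLpNorm_tsum_conv_le {ι : Type*} [AddCommGroup ι] [MeasurableSpace ι]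
    [MeasurableSingletonClass ι] (k f : ι → ℂ) {p q : ℝ≥0∞} {r : ℝ} (hp0 : p ≠ 0) (hpq : p < q)
    (hr : 1 ≤ r) (hqr : 1 / q.toReal ≤ 1 / r)
    (h : 1 / r + 1 / p.toReal = 1 + 1 / q.toReal) :
    eLpNorm (fun x => ∑' y, k (x - y) * f y) q Measure.count ≤
      (∑' y, ‖k y‖ₑ ^ r) ^ (1 / r) * eLpNorm f p Measure.count := by
  have hr0 : 0 < r := zero_lt_one.trans_le hr
  have hpt : p ≠ ∞ := hpq.ne_top
  have hp : 0 < p.toReal := ENNReal.toReal_pos hp0 hpt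
  have hθ : 0 ≤ 1 / q.toReal := div_nonneg zero_le_one ENNReal.toReal_nonneg
  have hr1 : 1 / r ≤ 1 := (div_le_one hr0).2 hr
  have hθp : 1 / q.toReal ≤ 1 / p.toReal := by linarith
  set A := ∑' y, ‖k y‖ₑ ^ r
  rw [eLpNorm_eq_lintegral_rpow_enorm_toReal hp0 hpt, lintegral_count]
  set B := ∑' y, ‖f y‖ₑ ^ p.toReal
  set K := A ^ (1 / r - 1 / q.toReal) * B ^ (1 / p.toReal - 1 / q.toReal)
  have hpt : ∀ x, ‖∑' y, k (x - y) * f y‖ₑ ≤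
      (∑' y, ‖k (x - y)‖ₑ ^ r * ‖f y‖ₑ ^ p.toReal) ^ (1 / q.toReal) * K := fun x => by
    refine enorm_tsum_le_tsum_enorm.trans ?_
    simp_rw [enorm_mul]
    exact tsum_mul_le_rpow_mul (fun y => ‖k y‖ₑ) (fun y => ‖f y‖ₑ) hp hr0 hθ hqr hθp h x
  rcases eq_or_ne q ∞ with rfl | hq
  · rw [eLpNorm_exponent_top, eLpNormEssSup_count]
    refine iSup_le fun x => (hpt x).trans (le_of_eq ?_)
    simp [K]
  · have hq0 : q ≠ 0 := hpq.ne_bot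
    have hqpos : 0 < q.toReal := ENNReal.toReal_pos hq0 hq
    have hsum : ∑' x, ∑' y, ‖k (x - y)‖ₑ ^ r * ‖f y‖ₑ ^ p.toReal = A * B := by
      rw [ENNReal.tsum_comm]
      simp_rw [ENNReal.tsum_mul_right]
      have hs : ∀ y, ∑' x, ‖k (x - y)‖ₑ ^ r = A := fun y =>
        (Equiv.subRight y).tsum_eq fun x => ‖k x‖ₑ ^ r
      simp_rw [hs, ENNReal.tsum_mul_left]
      rfl
    rw [eLpNorm_eq_lintegral_rpow_enorm_toReal hq0 hq, lintegral_count]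
    have hle : ∑' x, ‖∑' y, k (x - y) * f y‖ₑ ^ q.toReal ≤ A * B * K ^ q.toReal := by
      rw [← hsum, ← ENNReal.tsum_mul_right]
      refine ENNReal.tsum_le_tsum fun x => ?_
      refine (ENNReal.rpow_le_rpow (hpt x) hqpos.le).trans (le_of_eq ?_)
      rw [ENNReal.mul_rpow_of_nonneg _ _ hqpos.le, ← ENNReal.rpow_mul,
        one_div_mul_cancel hqpos.ne', ENNReal.rpow_one]
    refine (ENNReal.rpow_le_rpow hle hθ).trans (le_of_eq ?_)
    rw [ENNReal.mul_rpow_of_nonneg _ _ hθ, ENNReal.mul_rpow_of_nonneg _ _ hθ, ← ENNReal.rpow_mul,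
      mul_one_div_cancel hqpos.ne', ENNReal.rpow_one, mul_mul_mul_comm,
      ← ENNReal.rpow_add_of_nonneg _ _ hθ (sub_nonneg.2 hqr),
      ← ENNReal.rpow_add_of_nonneg _ _ hθ (sub_nonneg.2 hθp), add_sub_cancel, add_sub_cancel]

lemma tsum_rpow_rpow_le {ι : Type*} (a : ι → ℝ≥0∞) {r : ℝ} (hr : 2 ≤ r) {M S : ℝ≥0∞}
    (hM : ∀ y, a y ≤ M) (hS : ∑' y, a y ^ 2 ≤ S) :
    (∑' y, a y ^ r) ^ (1 / r) ≤ M ^ (1 - 2 / r) * S ^ (1 / r) := by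
  have hr0 : 0 < r := by linarith
  have h : ∑' y, a y ^ r ≤ M ^ (r - 2) * S := by
    refine le_trans ?_ (mul_le_mul_right hS _)
    rw [← ENNReal.tsum_mul_left]
    refine ENNReal.tsum_le_tsum fun y => ?_
    calc a y ^ r = a y ^ (r - 2) * a y ^ 2 := by
          rw [← ENNReal.rpow_two, ← ENNReal.rpow_add_of_nonneg _ _ (by linarith) zero_le_two,
            sub_add_cancel]
      _ ≤ _ := mul_le_mul_left (ENNReal.rpow_le_rpow (hM y) (by linarith)) _
  refine (ENNReal.rpow_le_rpow h (by positivity)).trans (le_of_eq ?_)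
  rw [ENNReal.mul_rpow_of_nonneg _ _ (by positivity), ← ENNReal.rpow_mul]
  congr 2
  field_simp

/-- Convolution with a bounded square-summable kernel maps `l^p` to `l^q`. -/
lemma eLpNorm_tsum_conv_le_of_le {ι : Type*} [AddCommGroup ι] [MeasurableSpace ι]
    [MeasurableSingletonClass ι] (k f : ι → ℂ) {p q M S : ℝ≥0∞} (hp1 : 1 ≤ p) (hpq : p < q)
    (h : 1 / q.toReal + 1 / 2 ≤ 1 / p.toReal)
    (hM : ∀ y, ‖k y‖ₑ ≤ M) (hS : ∑' y, ‖k y‖ₑ ^ 2 ≤ S) :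
    eLpNorm (fun x => ∑' y, k (x - y) * f y) q Measure.count ≤
      M ^ (2 * (1 / p.toReal - 1 / q.toReal) - 1) * S ^ (1 - (1 / p.toReal - 1 / q.toReal)) *
        eLpNorm f p Measure.count := by
  have hp0 : p ≠ 0 := (zero_lt_one.trans_le hp1).ne'
  have hp : 1 ≤ p.toReal := by
    rw [← ENNReal.toReal_one]
    exact ENNReal.toReal_mono hpq.ne_top hp1
  have hp' : 1 / p.toReal ≤ 1 := (div_le_one (by linarith)).2 hp
  have hθ : 0 ≤ 1 / q.toReal := div_nonneg zero_le_one ENNReal.toReal_nonneg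
  rcases (show 1 / p.toReal - 1 / q.toReal ≤ 1 by linarith).lt_or_eq with h1 | h1
  · set Δ := 1 / p.toReal - 1 / q.toReal with hΔ
    have hpos : 0 < 1 - Δ := sub_pos.2 h1
    have hr : 2 ≤ 1 / (1 - Δ) := by
      rw [le_div_iff₀ hpos]
      linarith
    refine (eLpNorm_tsum_conv_le k f (r := 1 / (1 - Δ)) hp0 hpq (by linarith) ?_ ?_).trans ?_
    · rw [one_div_one_div]; linarith
    · rw [one_div_one_div]; linarith
    · refine mul_le_mul_left ?_ _
      refine (tsum_rpow_rpow_le _ hr hM hS).trans (le_of_eq ?_)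
      rw [one_div_one_div, div_div_eq_mul_div, div_one]
      congr 2
      ring
  · have hp2 : p.toReal = 1 := by
      have h2 : 1 ≤ 1 / p.toReal := by linarith
      exact le_antisymm ((one_le_div (by linarith)).1 h2) hp
    have hp3 : p = 1 := by
      rw [← ENNReal.ofReal_toReal hpq.ne_top, hp2, ENNReal.ofReal_one]
    subst hp3
    have hq : q = ∞ := by
      by_contra hq
      have : 0 < 1 / q.toReal := one_div_pos.2 (ENNReal.toReal_pos hpq.ne_bot hq)
      linarith
    subst hq
    rw [h1, eLpNorm_exponent_top, eLpNormEssSup_count, eLpNorm_one_eq_lintegral_enorm,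
      lintegral_count]
    norm_num
    refine fun x => enorm_tsum_le_tsum_enorm.trans ?_
    rw [← ENNReal.tsum_mul_left]
    refine ENNReal.tsum_le_tsum fun y => ?_
    rw [enorm_mul]
    exact mul_le_mul_left (hM _) _

/-- `l^p → l^q` estimates for the linear discrete wave equation on `ℤ⁴`. -/
theorem lp_lq_estimate_dim4 :
    ∀ p q : ℝ≥0∞, 1 ≤ p → p < q →
      1 / q + 1 / 2 ≤ 1 / p →
      ∀ ε : ℝ, 0 < ε →
        ∃ C : ℝ, 0 < C ∧
          ∀ (t : ℝ) (f : (Fin 4 → ℤ) → ℂ),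
            lpNorm 4 q (fun x => ∑' y : Fin 4 → ℤ, greenG 4 (x - y) t * f y)
              ≤ ENNReal.ofReal
                  (C * (1 + |t|) ^ (-(3 - ε) * (1 / p.toReal - 1 / q.toReal - 1 / 2)))
                * lpNorm 4 p f := by
  intro p q hp1 hpq h ε hε
  have hp0 : p ≠ 0 := (zero_lt_one.trans_le hp1).ne'
  have hq0 : q ≠ 0 := hpq.ne_bot
  have hreal : 1 / q.toReal + 1 / 2 ≤ 1 / p.toReal := by
    have h' := ENNReal.toReal_mono (by simpa using hp0) h
    rw [ENNReal.toReal_add (by simpa using hq0) (by simp)] at h'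
    simpa using h'
  have hp : 1 ≤ p.toReal := by
    rw [← ENNReal.toReal_one]
    exact ENNReal.toReal_mono hpq.ne_top hp1
  have hp' : 1 / p.toReal ≤ 1 := (div_le_one (by linarith)).2 hp
  have hθ : 0 ≤ 1 / q.toReal := div_nonneg zero_le_one ENNReal.toReal_nonneg
  have hδ : 0 < min (ε / 2) (1 / 2) := lt_min (by linarith) (by norm_num)
  obtain ⟨C₁, hC₁, hG⟩ := exists_norm_greenG_le hδ (min_le_right _ _)
  obtain ⟨C₂, hC₂, hS⟩ := exists_tsum_enorm_greenG_sq_le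
  set δ := min (ε / 2) (1 / 2)
  have hδε : δ ≤ ε / 2 := min_le_left _ _
  set Δ := 1 / p.toReal - 1 / q.toReal with hΔ
  have hΔ0 : 0 ≤ 2 * Δ - 1 := by linarith
  have hΔ1 : 0 ≤ 1 - Δ := by linarith
  have hC₃ : 0 < C₂ + 1 := by linarith
  refine ⟨C₁ ^ (2 * Δ - 1) * (C₂ + 1) ^ (1 - Δ), by positivity, fun t f => ?_⟩
  have ht : 0 < 1 + |t| := by positivity
  have hm : 0 ≤ C₁ * (1 + |t|) ^ (-(3 / 2) + δ) := by positivity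
  refine (eLpNorm_tsum_conv_le_of_le (fun y => greenG 4 y t) f
    (M := ENNReal.ofReal (C₁ * (1 + |t|) ^ (-(3 / 2) + δ))) (S := ENNReal.ofReal (C₂ + 1)) hp1 hpq
    hreal (fun y => ?_) ((hS t).trans (ENNReal.ofReal_le_ofReal (by linarith)))).trans
    (mul_le_mul_left ?_ _)
  · rw [← ofReal_norm]
    exact ENNReal.ofReal_le_ofReal (hG t y)
  · rw [← hΔ, ENNReal.ofReal_rpow_of_nonneg hm hΔ0, ENNReal.ofReal_rpow_of_nonneg hC₃.le hΔ1,
      ← ENNReal.ofReal_mul (by positivity), Real.mul_rpow hC₁.le (by positivity),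
      ← Real.rpow_mul ht.le, mul_right_comm]
    refine ENNReal.ofReal_le_ofReal (mul_le_mul_of_nonneg_left ?_ (by positivity))
    refine Real.rpow_le_rpow_of_exponent_le (by linarith [abs_nonneg t]) ?_
    nlinarith [mul_le_mul_of_nonneg_right hδε hΔ0]
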